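/- Let U be a squared four-dimensional Bessel process started at 0 and τ₁^U := inf{ t ≥ 0 : Ū(t) − U(t) ≥ 1 }, where Ū(t) := sup_{s ∈ [0,t]} U(s). Then E[ τ₁^U ] = 1/2. -/

import Mathlib

open MeasureTheory ProbabilityTheory Real Set Filter

noncomputable section

variable {Ω : Type*} [MeasurableSpace Ω]

/-- A standard one-dimensional Brownian motion (indexed by `ℝ`, with the relevant
properties required for nonnegative times): starts at `0`, has continuous paths,
independent increments, and Gaussian increments of variance `t - s`. -/
structure IsStdBM (P : Measure Ω) (B : ℝ → Ω → ℝ) : Prop where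
  measurable : ∀ t : ℝ, Measurable (B t)
  start : ∀ ω, B 0 ω = 0
  cont : ∀ ω, Continuous fun t => B t ω
  indep : ∀ (n : ℕ) (t : Fin (n + 1) → ℝ), (∀ i, 0 ≤ t i) → Monotone t →
    iIndepFun
      (fun (i : Fin n) ω => B (t i.succ) ω - B (t i.castSucc) ω) P
  gauss : ∀ s t : ℝ, 0 ≤ s → s ≤ t →
    P.map (fun ω => B t ω - B s ω) = gaussianReal 0 (Real.toNNReal (t - s))

/-- A standard `d`-dimensional Brownian motion started at `0`: the coordinate
processes are independent standard one-dimensional Brownian motions. -/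
structure IsStdBMVec (d : ℕ) (P : Measure Ω) (B : ℝ → Ω → EuclideanSpace ℝ (Fin d)) : Prop where
  coord : ∀ i : Fin d, IsStdBM P (fun t ω => B t ω i)
  indepCoord : iIndepFun
    (fun (i : Fin d) ω => fun t : ℝ => B t ω i) P

/-- Last zero of `W` in `[0,1]`. -/
def lastZero (W : ℝ → Ω → ℝ) (ω : Ω) : ℝ := sSup {t ∈ Icc (0:ℝ) 1 | W t ω = 0}

/-- `m` is a standard Brownian meander: obtained from a Brownian motion `W` by
`m s = |W (g + s (1 - g))| / √(1 - g)`, where `g` is the last zero of `W` before time `1`. -/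
def IsBrownianMeander (P : Measure Ω) (m : ℝ → Ω → ℝ) : Prop :=
  ∃ W : ℝ → Ω → ℝ, IsStdBM P W ∧
    ∀ ω, ∀ s ∈ Icc (0:ℝ) 1,
      m s ω = |W (lastZero W ω + s * (1 - lastZero W ω)) ω| / Real.sqrt (1 - lastZero W ω)

/-- Running maximum `X̄(t) = sup_{s ∈ [0,t]} X(s)`. -/
def runMax (X : ℝ → Ω → ℝ) (t : ℝ) (ω : Ω) : ℝ := ⨆ s : Icc (0:ℝ) t, X s ω

/-- Maximal drawdown on `[0,T]` : `sup_{s ∈ [0,T]} (X̄(s) - X(s))`. -/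
def maxDDOn (X : ℝ → Ω → ℝ) (T : ℝ) (ω : Ω) : ℝ := ⨆ s : Icc (0:ℝ) T, (runMax X s ω - X s ω)

/-- Drawdown time `τ_λ^X := inf {t ≥ 0 : X̄(t) - X(t) ≥ λ}`. -/
def ddTime (lam : ℝ) (X : ℝ → Ω → ℝ) (ω : Ω) : ℝ :=
  sInf {t | 0 ≤ t ∧ lam ≤ runMax X t ω - X t ω}

/-- Three-dimensional Bessel process built from a 3-dimensional Brownian motion. -/
def bessel3 (β : ℝ → Ω → EuclideanSpace ℝ (Fin 3)) (t : ℝ) (ω : Ω) : ℝ := ‖β t ω‖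

/-- Squared four-dimensional Bessel process built from a 4-dimensional Brownian motion. -/
def sqBessel4 (γ : ℝ → Ω → EuclideanSpace ℝ (Fin 4)) (t : ℝ) (ω : Ω) : ℝ := ‖γ t ω‖ ^ 2

end


section Helpers

open MeasureTheory ProbabilityTheory Real Set Filter
open scoped ENNReal Topology

/-- Past sigma-algebra at time `t`, generated by rational fractions of `t`. -/
noncomputable def pastG {Ω : Type*} (γ : ℝ → Ω → EuclideanSpace ℝ (Fin 4)) (t : ℝ) (N : ℕ) : MeasurableSpace Ω :=
  ⨆ j : Fin (N + 2), MeasurableSpace.comap (γ (t * ((j : ℕ) / ((N : ℝ) + 1)))) inferInstance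

noncomputable def pastF {Ω : Type*} (γ : ℝ → Ω → EuclideanSpace ℝ (Fin 4)) (t : ℝ) : MeasurableSpace Ω :=
  ⨆ N : ℕ, pastG γ t N

lemma pastG_directed {Ω : Type*} (γ : ℝ → Ω → EuclideanSpace ℝ (Fin 4)) (t : ℝ) :
    Directed (· ≤ ·) (pastG γ t) := by
  have key : ∀ N M : ℕ, pastG γ t N ≤ pastG γ t ((N + 1) * (M + 1) - 1) := by
    intro N M
    refine iSup_le fun j => ?_
    have hj : (j : ℕ) * (M + 1) < ((N + 1) * (M + 1) - 1) + 2 := by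
      have h1 : (j : ℕ) ≤ N + 1 := by omega
      have h2 := Nat.mul_le_mul_right (M + 1) h1
      have : 0 < (N + 1) * (M + 1) := by positivity
      omega
    refine le_trans (le_of_eq ?_) (le_iSup _ (⟨(j : ℕ) * (M + 1), hj⟩ : Fin _))
    have : (((N + 1) * (M + 1) - 1 : ℕ) : ℝ) + 1 = ((N : ℝ) + 1) * (M + 1) := by
      have h : ((N + 1) * (M + 1) - 1) + 1 = (N + 1) * (M + 1) :=
        Nat.sub_add_cancel (Nat.mul_pos (Nat.succ_pos _) (Nat.succ_pos _))
      exact_mod_cast h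
    simp only [this]
    congr 3
    push_cast
    field_simp
  intro N M
  refine ⟨(N + 1) * (M + 1) - 1, key N M, ?_⟩
  rw [mul_comm]
  exact key M N

lemma BM_measurable {Ω : Type*} [MeasurableSpace Ω] {P : Measure Ω}
    {γ : ℝ → Ω → EuclideanSpace ℝ (Fin 4)} (hγ : IsStdBMVec 4 P γ) (t : ℝ) : Measurable (γ t) := by
  have : Measurable (fun ω => (MeasurableEquiv.toLp 2 (Fin 4 → ℝ)) (fun i => γ t ω i)) :=
    (MeasurableEquiv.measurable _).comp (measurable_pi_lambda _ fun i => (hγ.coord i).measurable t)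
  exact this

lemma pastG_le {Ω : Type*} [m : MeasurableSpace Ω] {P : Measure Ω}
    {γ : ℝ → Ω → EuclideanSpace ℝ (Fin 4)} (hγ : IsStdBMVec 4 P γ) (t : ℝ) (N : ℕ) :
    pastG γ t N ≤ m :=
  iSup_le fun _ => (BM_measurable hγ _).comap_le

lemma pastF_le {Ω : Type*} [m : MeasurableSpace Ω] {P : Measure Ω}
    {γ : ℝ → Ω → EuclideanSpace ℝ (Fin 4)} (hγ : IsStdBMVec 4 P γ) (t : ℝ) :
    pastF γ t ≤ m :=
  iSup_le fun _ => pastG_le hγ _ _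

lemma measurable_pastF {Ω : Type*} (γ : ℝ → Ω → EuclideanSpace ℝ (Fin 4)) (t : ℝ)
    (j N : ℕ) (hj : j ≤ N + 1) :
    Measurable[pastF γ t] (γ (t * ((j : ℕ) / ((N : ℝ) + 1)))) := by
  refine Measurable.mono (comap_measurable _) ?_ le_rfl
  refine le_trans ?_ (le_iSup _ N)
  exact le_iSup (fun j : Fin (N + 2) => MeasurableSpace.comap (γ (t * ((j : ℕ) / ((N : ℝ) + 1)))) inferInstance)
    ⟨j, by omega⟩

lemma stdBM_nat {Ω : Type*} [MeasurableSpace Ω] {P : Measure Ω} {B : ℝ → Ω → ℝ}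
    (hB : IsStdBM P B) (t : ℕ → ℝ) (h0 : ∀ i, 0 ≤ t i) (ht : Monotone t) :
    iIndepFun (fun (i : ℕ) ω => B (t (i + 1)) ω - B (t i) ω) P := by
  have : HasIndepIncrements (fun s : NNReal => B s) P := by
    intro n s hs
    exact hB.indep n (fun i => s i) (fun i => (s i).2) (fun i j hij => hs hij)
  exact this.nat (t := fun i => ⟨t i, h0 i⟩) (fun i j hij => ht hij)

lemma meas_add_aux {Ω : Type*} (m' : MeasurableSpace Ω) {f g : Ω → ℝ} (hf : Measurable[m'] f)
    (hg : Measurable[m'] g) : Measurable[m'] (fun ω => f ω + g ω) := hf.add hg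

lemma meas_coords_aux {Ω : Type*} (m' : MeasurableSpace Ω) (f : Ω → EuclideanSpace ℝ (Fin 4))
    (h : ∀ i, Measurable[m'] (fun ω => f ω i)) : Measurable[m'] f := by
  have : Measurable[m'] (fun ω => (MeasurableEquiv.toLp 2 (Fin 4 → ℝ)) (fun i => f ω i)) :=
    (MeasurableEquiv.measurable _).comp (measurable_pi_lambda _ h)
  exact this

set_option maxHeartbeats 1000000 in
lemma indep_pastF {Ω : Type*} [m : MeasurableSpace Ω] {P : Measure Ω} [IsProbabilityMeasure P]
    {γ : ℝ → Ω → EuclideanSpace ℝ (Fin 4)} (hγ : IsStdBMVec 4 P γ) {t r : ℝ} (ht : 0 ≤ t)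
    (htr : t ≤ r) :
    Indep (pastF γ t) (MeasurableSpace.comap (fun ω => γ r ω - γ t ω) inferInstance) P := by
  have hZm : Measurable (fun ω => γ r ω - γ t ω) := (BM_measurable hγ r).sub (BM_measurable hγ t)
  refine indep_iSup_of_directed_le (fun N => ?_) (fun N => pastG_le hγ _ _) hZm.comap_le
    (pastG_directed γ t)
  let s : ℕ → ℝ := fun j => if j ≤ N + 1 then t * (j / ((N : ℝ) + 1)) else r
  have hs0 : ∀ i, 0 ≤ s i := by
    intro i; simp only [s]; split_ifs
    · positivity
    · linarith
  have hs : Monotone s := by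
    intro i j hij
    simp only [s]
    split_ifs with h1 h2 h3
    · gcongr
    · refine le_trans ?_ htr
      have : (i : ℝ) / ((N : ℝ) + 1) ≤ 1 := by
        rw [div_le_one (by positivity)]; exact_mod_cast h1
      nlinarith
    · omega
    · exact le_rfl
  let X : Fin 4 → ℕ → Ω → ℝ := fun i j ω => γ (s (j + 1)) ω i - γ (s j) ω i
  have mX : ∀ i j, Measurable (X i j) := fun i j =>
    ((hγ.coord i).measurable _).sub ((hγ.coord i).measurable _)
  have hX : iIndepFun (fun (p : Fin 4 × ℕ) ω => X p.1 p.2 ω) P := by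
    refine iIndepFun_uncurry' mX ?_ (fun i => stdBM_nat (hγ.coord i) s hs0 hs)
    exact hγ.indepCoord.comp (fun _ f j => f (s (j + 1)) - f (s j))
      (fun _ => measurable_pi_lambda _ fun j => (measurable_pi_apply _).sub (measurable_pi_apply _))
  have hstart : ∀ i ω, γ 0 ω i = 0 := fun i ω => (hγ.coord i).start ω
  have hI := indep_iSup_of_disjoint
    (m := fun p : Fin 4 × ℕ => MeasurableSpace.comap (fun ω => X p.1 p.2 ω) inferInstance)
    (fun p => (mX p.1 p.2).comap_le) hX
    (S := {p : Fin 4 × ℕ | p.2 < N + 1}) (T := {p : Fin 4 × ℕ | p.2 = N + 1})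
    (by rw [Set.disjoint_left]; intro p h1 h2; exact absurd h1 (by rw [Set.mem_ofPred_eq] at *; omega))
  set m1 : MeasurableSpace Ω := ⨆ p ∈ {p : Fin 4 × ℕ | p.2 < N + 1},
    MeasurableSpace.comap (fun ω => X p.1 p.2 ω) inferInstance with hm1
  set m2 : MeasurableSpace Ω := ⨆ p ∈ {p : Fin 4 × ℕ | p.2 = N + 1},
    MeasurableSpace.comap (fun ω => X p.1 p.2 ω) inferInstance with hm2
  have e1 : ∀ i j, j < N + 1 → Measurable[m1] (X i j) := by
    intro i j hj
    refine Measurable.mono (comap_measurable _) ?_ le_rfl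
    exact le_iSup₂ (f := fun (p : Fin 4 × ℕ) (_ : p ∈ {p : Fin 4 × ℕ | p.2 < N + 1}) =>
      MeasurableSpace.comap (fun ω => X p.1 p.2 ω) inferInstance) (i, j) hj
  have e2 : ∀ i, Measurable[m2] (X i (N + 1)) := by
    intro i
    refine Measurable.mono (comap_measurable _) ?_ le_rfl
    exact le_iSup₂ (f := fun (p : Fin 4 × ℕ) (_ : p ∈ {p : Fin 4 × ℕ | p.2 = N + 1}) =>
      MeasurableSpace.comap (fun ω => X p.1 p.2 ω) inferInstance) (i, N + 1) rfl
  refine indep_of_indep_of_le_left (indep_of_indep_of_le_right hI ?_) ?_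
  · refine Measurable.comap_le ?_
    have : Measurable[m2] (fun ω => (MeasurableEquiv.toLp 2 (Fin 4 → ℝ)) (fun i => X i (N + 1) ω)) :=
      (MeasurableEquiv.measurable _).comp (measurable_pi_lambda _ fun i => e2 i)
    convert this using 1
    ext ω i
    have a1 : s (N + 1 + 1) = r := by simp [s]
    have a2 : s (N + 1) = t := by
      simp only [s, le_refl, if_true]; push_cast; field_simp
    simp [X, a1, a2]
  · refine iSup_le fun j => Measurable.comap_le ?_
    have hsum : ∀ k, k ≤ N + 1 → ∀ i, Measurable[m1] (fun ω => γ (s k) ω i) := by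
      intro k hk i
      induction k with
      | zero =>
        have : (fun ω => γ (s 0) ω i) = fun _ => 0 := by
          funext ω
          have := hstart i ω
          simpa [s] using this
        rw [this]; exact measurable_const
      | succ k ih =>
        have : (fun ω => γ (s (k + 1)) ω i) = fun ω => γ (s k) ω i + X i k ω := by
          funext ω; simp [X]
        rw [this]
        exact meas_add_aux m1 (ih (by omega)) (e1 i k (by omega))
    have hj : (j : ℕ) ≤ N + 1 := by omega
    have := meas_coords_aux m1 (γ (s j)) (hsum j hj)
    have a : s j = t * ((j : ℕ) / ((N : ℝ) + 1)) := by simp only [s, hj, if_true]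
    rw [a] at this
    exact this

/-- Freezing lemma. -/
lemma freeze {Ω : Type*} [m : MeasurableSpace Ω] {P : Measure Ω} [IsProbabilityMeasure P]
    {γ : ℝ → Ω → EuclideanSpace ℝ (Fin 4)} (hγ : IsStdBMVec 4 P γ) {t r : ℝ} (ht : 0 ≤ t)
    (htr : t ≤ r) {Y : Ω → ℝ} (hY : Measurable[pastF γ t] Y)
    {G : EuclideanSpace ℝ (Fin 4) → ℝ} (hG : Measurable G)
    (hInt : Integrable (fun ω => Y ω * G (γ r ω)) P) :
    ∫ ω, Y ω * G (γ r ω) ∂P = ∫ ω, Y ω * (∫ ω', G (γ t ω + (γ r ω' - γ t ω')) ∂P) ∂P := by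
  have hZm : Measurable (fun ω => γ r ω - γ t ω) := (BM_measurable hγ r).sub (BM_measurable hγ t)
  have hγt : Measurable[pastF γ t] (γ t) := by
    have := measurable_pastF γ t 1 0 (by norm_num)
    simpa using this
  have hW' : Measurable[pastF γ t] (fun ω => (Y ω, γ t ω)) := hY.prodMk hγt
  have hW : Measurable (fun ω => (Y ω, γ t ω)) := hW'.mono (pastF_le hγ t) le_rfl
  have hI : IndepFun (fun ω => (Y ω, γ t ω)) (fun ω => γ r ω - γ t ω) P :=
    indep_of_indep_of_le_left (indep_pastF hγ ht htr) hW'.comap_le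
  have hmap := hI.map_prod_eq_prod_map_map hW.aemeasurable hZm.aemeasurable
  let φ : (ℝ × EuclideanSpace ℝ (Fin 4)) × EuclideanSpace ℝ (Fin 4) → ℝ :=
    fun p => p.1.1 * G (p.1.2 + p.2)
  have hφ : Measurable φ := by
    have : Measurable fun p : (ℝ × EuclideanSpace ℝ (Fin 4)) × EuclideanSpace ℝ (Fin 4) =>
      G (p.1.2 + p.2) := hG.comp (by fun_prop)
    exact (measurable_fst.comp measurable_fst).mul this
  have e : (fun ω => Y ω * G (γ r ω)) = fun ω => φ ((Y ω, γ t ω), γ r ω - γ t ω) := by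
    funext ω; simp [φ]
  have hWZ := hW.prodMk hZm
  rw [e] at hInt ⊢
  have hint2 : Integrable φ (P.map (fun ω => ((Y ω, γ t ω), γ r ω - γ t ω))) :=
    (integrable_map_measure hφ.aestronglyMeasurable hWZ.aemeasurable).2 hInt
  rw [← integral_map (f := φ) hWZ.aemeasurable hφ.aestronglyMeasurable]
  rw [hmap] at hint2 ⊢
  rw [integral_prod _ hint2, integral_map hW.aemeasurable]
  · congr 1
    funext ω
    rw [integral_map hZm.aemeasurable]
    · simp only [φ]
      rw [integral_const_mul]
    · exact (hφ.comp (measurable_prodMk_left)).aestronglyMeasurable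
  · exact hφ.stronglyMeasurable.integral_prod_right'.aestronglyMeasurable

open MeasureTheory ProbabilityTheory Real Set Filter
open scoped ENNReal Topology

lemma gauss_exp (v : NNReal) (hv : v ≠ 0) (μ x : ℝ) (hμ : 0 ≤ μ) :
    ∫ z, exp (-(μ * (x + z) ^ 2)) ∂(gaussianReal 0 v) =
      (√(1 + 2 * μ * v))⁻¹ * exp (-(μ / (1 + 2 * μ * v) * x ^ 2)) := by
  have hv' : (0 : ℝ) < v := by positivity
  have hw : 0 < 1 + 2 * μ * v := by positivity
  rw [integral_gaussianReal_eq_integral_smul hv]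
  let w : NNReal := ⟨1 + 2 * μ * v, hw.le⟩
  have hwne : w ≠ 0 := by
    intro h
    have : (w : ℝ) = 0 := by rw [h]; rfl
    exact hw.ne' this
  have key : ∀ z, gaussianPDFReal 0 v z • exp (-(μ * (x + z) ^ 2)) =
      (√(1 + 2 * μ * v))⁻¹ * exp (-(μ / (1 + 2 * μ * v) * x ^ 2)) *
        gaussianPDFReal (-(2 * μ * v * x) / (1 + 2 * μ * v)) (v / w) z := by
    intro z
    have hvw : ((v / w : NNReal) : ℝ) = v / (1 + 2 * μ * v) := by
      rw [NNReal.coe_div]; rfl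
    rw [gaussianPDFReal, gaussianPDFReal, hvw, smul_eq_mul, sub_zero]
    have h1 : √(2 * π * v) = √(1 + 2 * μ * v) * √(2 * π * (v / (1 + 2 * μ * v))) := by
      rw [← Real.sqrt_mul hw.le]; congr 1; field_simp
    rw [h1, mul_inv]
    have h2 : exp (-z ^ 2 / (2 * v)) * exp (-(μ * (x + z) ^ 2)) =
        exp (-(μ / (1 + 2 * μ * v) * x ^ 2)) *
        exp (-(z - -(2 * μ * v * x) / (1 + 2 * μ * v)) ^ 2 / (2 * (v / (1 + 2 * μ * v)))) := by
      rw [← Real.exp_add, ← Real.exp_add]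
      congr 1
      field_simp
      ring
    linear_combination (√(1 + 2 * μ * v))⁻¹ * (√(2 * π * (v / (1 + 2 * μ * v))))⁻¹ * h2
  simp_rw [key]
  rw [integral_const_mul, integral_gaussianPDFReal_eq_one _ (div_ne_zero hv hwne), mul_one]

lemma gauss_sq (v : NNReal) (x : ℝ) :
    ∫ z, (x + z) ^ 2 ∂(gaussianReal 0 v) = x ^ 2 + v := by
  have h1 : Integrable (fun z : ℝ => z) (gaussianReal 0 v) :=
    (memLp_id_gaussianReal 1).integrable le_rfl
  have h2 : Integrable (fun z : ℝ => z ^ 2) (gaussianReal 0 v) :=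
    (memLp_id_gaussianReal (μ := 0) (v := v) 2).integrable_sq
  have hvar := variance_fun_id_gaussianReal (μ := 0) (v := v)
  rw [variance_eq_integral (by fun_prop), integral_id_gaussianReal] at hvar
  simp only [sub_zero] at hvar
  have : (fun z : ℝ => (x + z) ^ 2) = fun z => x ^ 2 + (2 * x * z + z ^ 2) := by
    funext z; ring
  have h3 : Integrable (fun z : ℝ => 2 * x * z) (gaussianReal 0 v) := h1.const_mul _
  have h4 : Integrable (fun z : ℝ => 2 * x * z + z ^ 2) (gaussianReal 0 v) := h3.add h2
  rw [this, integral_add (integrable_const _) h4, integral_add h3 h2, integral_const_mul, integral_id_gaussianReal, hvar]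
  simp

set_option linter.unusedSectionVars false
section
variable {Ω : Type*} [m : MeasurableSpace Ω] {P : Measure Ω} [IsProbabilityMeasure P]
  {γ : ℝ → Ω → EuclideanSpace ℝ (Fin 4)}

lemma incr_exp (hγ : IsStdBMVec 4 P γ) {t r : ℝ} (ht : 0 ≤ t) (htr : t < r) {μ : ℝ} (hμ : 0 ≤ μ)
    (x : EuclideanSpace ℝ (Fin 4)) :
    ∫ ω, exp (-(μ * ‖x + (γ r ω - γ t ω)‖ ^ 2)) ∂P =
      ((1 + 2 * μ * (r - t)) ^ 2)⁻¹ * exp (-(μ / (1 + 2 * μ * (r - t)) * ‖x‖ ^ 2)) := by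
  have hv : (r - t).toNNReal ≠ 0 := by
    rw [Ne, Real.toNNReal_eq_zero, not_le]; linarith
  have hvc : ((r - t).toNNReal : ℝ) = r - t := Real.coe_toNNReal _ (by linarith)
  have hind : iIndepFun (fun (i : Fin 4) ω => exp (-(μ * (x i + (γ r ω i - γ t ω i)) ^ 2))) P :=
    hγ.indepCoord.comp (fun i f => exp (-(μ * (x i + (f r - f t)) ^ 2)))
      (fun i => by fun_prop)
  have hm : ∀ i, Measurable (fun ω => γ r ω i - γ t ω i) := fun i =>
    ((hγ.coord i).measurable _).sub ((hγ.coord i).measurable _)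
  have h1 : ∀ i, ∫ ω, exp (-(μ * (x i + (γ r ω i - γ t ω i)) ^ 2)) ∂P =
      (√(1 + 2 * μ * (r - t)))⁻¹ * exp (-(μ / (1 + 2 * μ * (r - t)) * x i ^ 2)) := by
    intro i
    have := gauss_exp _ hv μ (x i) hμ
    rw [← (hγ.coord i).gauss t r ht htr.le, integral_map (hm i).aemeasurable
      (Measurable.aestronglyMeasurable (by fun_prop)), hvc] at this
    exact this
  have h2 : (fun ω => exp (-(μ * ‖x + (γ r ω - γ t ω)‖ ^ 2))) =
      fun ω => ∏ i, exp (-(μ * (x i + (γ r ω i - γ t ω i)) ^ 2)) := by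
    funext ω
    rw [EuclideanSpace.real_norm_sq_eq, Finset.mul_sum, ← Finset.sum_neg_distrib, Real.exp_sum]
    rfl
  have hms : ∀ i, AEStronglyMeasurable (fun ω => exp (-(μ * (x i + (γ r ω i - γ t ω i)) ^ 2))) P := by
    intro i
    have := hm i
    exact Measurable.aestronglyMeasurable (by fun_prop)
  rw [h2, hind.integral_fun_prod_eq_prod_integral hms]
  simp_rw [h1]
  rw [Finset.prod_mul_distrib, ← Real.exp_sum, Finset.sum_neg_distrib, ← Finset.mul_sum,
    ← EuclideanSpace.real_norm_sq_eq]
  congr 1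
  have hw : 0 ≤ 1 + 2 * μ * (r - t) := by nlinarith [mul_nonneg hμ (sub_nonneg.2 htr.le)]
  rw [Finset.prod_const, Finset.card_univ, Fintype.card_fin, inv_pow,
    show (√(1 + 2 * μ * (r - t))) ^ 4 = ((√(1 + 2 * μ * (r - t))) ^ 2) ^ 2 by ring, Real.sq_sqrt hw]

lemma coord_memLp (hγ : IsStdBMVec 4 P γ) {t r : ℝ} (ht : 0 ≤ t) (htr : t ≤ r) (i : Fin 4)
    (p : NNReal) : MemLp (fun ω => γ r ω i - γ t ω i) p P := by
  have hm : Measurable (fun ω => γ r ω i - γ t ω i) :=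
    ((hγ.coord i).measurable _).sub ((hγ.coord i).measurable _)
  have := memLp_id_gaussianReal (μ := 0) (v := (r - t).toNNReal) p
  rw [← (hγ.coord i).gauss t r ht htr] at this
  exact (memLp_map_measure_iff aestronglyMeasurable_id hm.aemeasurable).1 this

lemma coord_memLp0 (hγ : IsStdBMVec 4 P γ) {r : ℝ} (htr : 0 ≤ r) (i : Fin 4)
    (p : NNReal) : MemLp (fun ω => γ r ω i) p P := by
  have := coord_memLp hγ le_rfl htr i p
  have e : (fun ω => γ r ω i - γ 0 ω i) = fun ω => γ r ω i := by
    funext ω; rw [show γ 0 ω i = 0 from (hγ.coord i).start ω, sub_zero]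
  rwa [e] at this

lemma incr_sq (hγ : IsStdBMVec 4 P γ) {t r : ℝ} (ht : 0 ≤ t) (htr : t ≤ r)
    (x : EuclideanSpace ℝ (Fin 4)) :
    ∫ ω, ‖x + (γ r ω - γ t ω)‖ ^ 2 ∂P = ‖x‖ ^ 2 + 4 * (r - t) := by
  have hvc : ((r - t).toNNReal : ℝ) = r - t := Real.coe_toNNReal _ (by linarith)
  have hm : ∀ i, Measurable (fun ω => γ r ω i - γ t ω i) := fun i =>
    ((hγ.coord i).measurable _).sub ((hγ.coord i).measurable _)
  have h1 : ∀ i, ∫ ω, (x i + (γ r ω i - γ t ω i)) ^ 2 ∂P = x i ^ 2 + (r - t) := by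
    intro i
    have := gauss_sq (r - t).toNNReal (x i)
    rw [← (hγ.coord i).gauss t r ht htr, integral_map (hm i).aemeasurable
      (Measurable.aestronglyMeasurable (by fun_prop)), hvc] at this
    exact this
  have h2 : (fun ω => ‖x + (γ r ω - γ t ω)‖ ^ 2) =
      fun ω => ∑ i, (x i + (γ r ω i - γ t ω i)) ^ 2 := by
    funext ω
    rw [EuclideanSpace.real_norm_sq_eq]
    rfl
  rw [h2, integral_finsetSum _ (fun i _ => by
    have := coord_memLp hγ ht htr i 2
    exact ((memLp_const (x i)).add this).integrable_sq)]
  simp_rw [h1]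
  rw [Finset.sum_add_distrib, EuclideanSpace.real_norm_sq_eq]
  simp
  ring

lemma U_memLp (hγ : IsStdBMVec 4 P γ) {t : ℝ} (ht : 0 ≤ t) : MemLp (fun ω => ‖γ t ω‖ ^ 2) 2 P := by
  have h : (fun ω => ‖γ t ω‖ ^ 2) = fun ω => ∑ i, (γ t ω i) ^ 2 := by
    funext ω; rw [EuclideanSpace.real_norm_sq_eq]
  rw [h]
  refine memLp_finsetSum _ fun i _ => ?_
  have hm := (hγ.coord i).measurable t
  have h4 : MemLp (fun ω => γ t ω i) ((4 : ℕ) : ℝ≥0∞) P := by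
    have := coord_memLp0 hγ ht i 4
    exact_mod_cast this
  rw [memLp_two_iff_integrable_sq (hm.pow_const 2).aestronglyMeasurable]
  refine (h4.integrable_norm_pow (by norm_num)).congr (Eventually.of_forall fun ω => ?_)
  simp only [Real.norm_eq_abs]
  rw [← pow_mul, Even.pow_abs (by decide)]

end

open MeasureTheory ProbabilityTheory Real Set Filter
open scoped ENNReal Topology

/-- Regularised `1/u`: the heat-kernel potential at regularisation level `c`. -/
noncomputable def gfun (c u : ℝ) : ℝ := ∫ μ in (0:ℝ)..1 / (2 * c), exp (-(μ * u))

lemma gfun_continuous (c : ℝ) : Continuous (gfun c) := by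
  unfold gfun
  exact intervalIntegral.continuous_parametric_intervalIntegral_of_continuous' (by fun_prop) _ _

lemma gfun_of_pos {c u : ℝ} (hu : 0 < u) : gfun c u = (1 - exp (-(u / (2 * c)))) / u := by
  unfold gfun
  have hd : ∀ x ∈ uIcc (0:ℝ) (1 / (2 * c)), HasDerivAt (fun μ => -(exp (-(μ * u)) / u)) (exp (-(x * u))) x := by
    intro x _
    have h1 : HasDerivAt (fun μ : ℝ => -(μ * u)) (-u) x := by
      simpa using ((hasDerivAt_id' x).mul_const u).fun_neg
    refine ((h1.exp.div_const u).fun_neg).congr_deriv ?_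
    field_simp
  rw [intervalIntegral.integral_eq_sub_of_hasDerivAt hd
    ((by fun_prop : Continuous fun μ => exp (-(μ * u))).intervalIntegrable _ _)]
  simp
  rw [show c⁻¹ * 2⁻¹ * u = u / (2 * c) by rw [div_eq_mul_inv, mul_inv]; ring]
  field_simp
  ring

lemma gfun_zero (c : ℝ) : gfun c 0 = 1 / (2 * c) := by
  simp [gfun]

lemma gfun_nonneg {c : ℝ} (hc : 0 < c) (u : ℝ) : 0 ≤ gfun c u :=
  intervalIntegral.integral_nonneg (by positivity) fun _ _ => (exp_pos _).le

lemma gfun_le {c u : ℝ} (hc : 0 < c) (hu : 0 ≤ u) : gfun c u ≤ 1 / (2 * c) := by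
  have h : gfun c u ≤ ∫ _ in (0:ℝ)..1 / (2 * c), (1:ℝ) := by
    refine intervalIntegral.integral_mono_on (by positivity)
      ((by fun_prop : Continuous fun μ => exp (-(μ * u))).intervalIntegrable _ _)
      (continuous_const.intervalIntegrable _ _) fun x hx => ?_
    rw [exp_le_one_iff]
    have := mul_nonneg hx.1 hu
    linarith
  simpa using h

lemma gfun_le_inv {c u : ℝ} (hu : 0 < u) : gfun c u ≤ 1 / u := by
  rw [gfun_of_pos hu]
  gcongr
  have := exp_pos (-(u / (2 * c)))
  linarith

lemma gfun_sub {c h : ℝ} (u : ℝ) : gfun c u - gfun (c + h) u =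
    ∫ μ in (1 / (2 * (c + h)))..(1 / (2 * c)), exp (-(μ * u)) := by
  unfold gfun
  have hi : ∀ a b, IntervalIntegrable (fun μ => exp (-(μ * u))) volume a b := fun a b =>
    (by fun_prop : Continuous fun μ => exp (-(μ * u))).intervalIntegrable _ _
  rw [sub_eq_iff_eq_add, add_comm, intervalIntegral.integral_add_adjacent_intervals (hi _ _) (hi _ _)]

lemma gfun_sub_nonneg {c h : ℝ} (hc : 0 < c) (hh : 0 ≤ h) (u : ℝ) :
    0 ≤ gfun c u - gfun (c + h) u := by
  rw [gfun_sub]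
  exact intervalIntegral.integral_nonneg (by gcongr; linarith) fun _ _ => (exp_pos _).le

lemma gfun_sub_le {c h u : ℝ} (hc : 0 < c) (hh : 0 ≤ h) (hu : 0 ≤ u) :
    gfun c u - gfun (c + h) u ≤ h / (2 * c ^ 2) * exp (-(u / (2 * (c + h)))) := by
  rw [gfun_sub]
  have hle : 1 / (2 * (c + h)) ≤ 1 / (2 * c) := by gcongr; linarith
  have h1 : ∫ μ in (1 / (2 * (c + h)))..(1 / (2 * c)), exp (-(μ * u)) ≤
      ∫ _ in (1 / (2 * (c + h)))..(1 / (2 * c)), exp (-(u / (2 * (c + h)))) := by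
    refine intervalIntegral.integral_mono_on hle
      ((by fun_prop : Continuous fun μ => exp (-(μ * u))).intervalIntegrable _ _)
      (continuous_const.intervalIntegrable _ _) fun x hx => ?_
    rw [exp_le_exp]
    have := mul_le_mul_of_nonneg_right hx.1 hu
    rw [div_mul_eq_mul_div, one_mul] at this
    linarith
  refine h1.trans ?_
  rw [intervalIntegral.integral_const, smul_eq_mul]
  gcongr
  have h3 : (0:ℝ) < c + h := by linarith
  rw [div_sub_div _ _ (by positivity) (by positivity), div_le_div_iff₀ (by positivity) (by positivity)]
  have : 0 ≤ c * h ^ 2 * c := by positivity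
  have : 0 ≤ c^2 * h ^ 2 := by positivity
  nlinarith

section
variable {Ω : Type*} [MeasurableSpace Ω] {P : Measure Ω} [IsProbabilityMeasure P]
    {γ : ℝ → Ω → EuclideanSpace ℝ (Fin 4)}

lemma gfun_heat (hγ : IsStdBMVec 4 P γ) {t r c : ℝ} (ht : 0 ≤ t) (htr : t < r) (hc : 0 < c)
    (x : EuclideanSpace ℝ (Fin 4)) :
    ∫ ω, gfun c (‖x + (γ r ω - γ t ω)‖ ^ 2) ∂P = gfun (c + (r - t)) (‖x‖ ^ 2) := by
  have hm : Measurable (fun ω => ‖x + (γ r ω - γ t ω)‖ ^ 2) :=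
    ((((BM_measurable hγ r).sub (BM_measurable hγ t)).const_add x).norm).pow_const 2
  unfold gfun
  rw [← intervalIntegral_integral_swap]
  · have hpos : (0:ℝ) ≤ 1 / (2 * c) := by positivity
    have hh : 0 < r - t := by linarith
    have e1 : ∫ μ in (0:ℝ)..1 / (2 * c), ∫ ω, exp (-(μ * ‖x + (γ r ω - γ t ω)‖ ^ 2)) ∂P =
      ∫ μ in (0:ℝ)..1 / (2 * c), ((fun ν => exp (-(ν * ‖x‖ ^ 2))) ∘
        (fun μ => μ / (1 + 2 * μ * (r - t)))) μ * ((1 + 2 * μ * (r - t)) ^ 2)⁻¹ := by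
      refine intervalIntegral.integral_congr fun μ hμ => ?_
      rw [uIcc_of_le hpos] at hμ
      simp only [Function.comp]
      rw [incr_exp hγ ht htr hμ.1, mul_comm]
    rw [e1, intervalIntegral.integral_comp_mul_deriv]
    · congr 1
      · simp
      · field_simp
    · intro μ hμ
      rw [uIcc_of_le hpos] at hμ
      have hp : 0 < 1 + 2 * μ * (r - t) := by have := hμ.1; positivity
      have h1 : HasDerivAt (fun μ : ℝ => 1 + 2 * μ * (r - t)) (2 * (r - t)) μ := by
        have := (((hasDerivAt_id μ).const_mul 2).mul_const (r - t)).const_add 1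
        simpa using this
      refine ((hasDerivAt_id' μ).fun_div h1 hp.ne').congr_deriv ?_
      field_simp
      ring
    · refine ContinuousOn.inv₀ (by fun_prop) fun μ hμ => ?_
      rw [uIcc_of_le hpos] at hμ
      have hp : 0 < 1 + 2 * μ * (r - t) := by have := hμ.1; positivity
      positivity
    · fun_prop
  · have hmeas : Measurable (Function.uncurry fun (μ : ℝ) ω => exp (-(μ * ‖x + (γ r ω - γ t ω)‖ ^ 2))) := by
      have h1 : Measurable (fun p : ℝ × Ω => p.1 * ‖x + (γ r p.2 - γ t p.2)‖ ^ 2) :=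
        measurable_fst.mul (hm.comp measurable_snd)
      exact h1.neg.exp
    have : IsFiniteMeasure (volume.restrict (uIoc (0:ℝ) (1 / (2 * c)))) := by
      constructor; simp [uIoc]
    have hae : ∀ᵐ p ∂((volume.restrict (uIoc (0:ℝ) (1 / (2 * c)))).prod P), p.1 ∈ uIoc (0:ℝ) (1 / (2 * c)) := by
      have := Measure.quasiMeasurePreserving_fst (μ := volume.restrict (uIoc (0:ℝ) (1 / (2 * c)))) (ν := P)
      exact this.ae (ae_restrict_mem measurableSet_uIoc)
    refine Integrable.mono' (integrable_const (1:ℝ)) hmeas.aestronglyMeasurable ?_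
    filter_upwards [hae] with p hp
    rw [uIoc_of_le (by positivity)] at hp
    simp only [Function.uncurry]
    rw [Real.norm_eq_abs, abs_of_pos (exp_pos _), exp_le_one_iff]
    have := hp.1
    have : 0 ≤ p.1 * ‖x + (γ r p.2 - γ t p.2)‖ ^ 2 := by positivity
    linarith

end

open MeasureTheory ProbabilityTheory Real Set Filter
open scoped ENNReal Topology

/-- The path has drawdown at most `lam` up to time `t`. -/
def okDD (lam : ℝ) (u : ℝ → ℝ) (t : ℝ) : Prop :=
  ∀ s r, 0 ≤ s → s ≤ r → r ≤ t → u s - u r ≤ lam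

lemma okDD_mono {lam : ℝ} {u : ℝ → ℝ} {t t' : ℝ} (h : t ≤ t') (hok : okDD lam u t') :
    okDD lam u t := fun s r hs hsr hr => hok s r hs hsr (hr.trans h)

/-- Discrete running maximum started at `m0`. -/
noncomputable def mseq (m0 : ℝ) (u : ℝ → ℝ) (h : ℝ) : ℕ → ℝ
  | 0 => m0
  | k + 1 => max (mseq m0 u h k) (u (((k + 1 : ℕ) : ℝ) * h))

lemma mseq_mono (m0 : ℝ) (u : ℝ → ℝ) (h : ℝ) : Monotone (mseq m0 u h) :=
  monotone_nat_of_le_succ fun _ => le_max_left _ _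

lemma mseq_ge (m0 : ℝ) (u : ℝ → ℝ) (h : ℝ) (k : ℕ) : m0 ≤ mseq m0 u h k :=
  mseq_mono m0 u h (Nat.zero_le k)

lemma mseq_cases (m0 : ℝ) (u : ℝ → ℝ) (h : ℝ) (k : ℕ) :
    mseq m0 u h k = m0 ∨ ∃ j ≤ k, mseq m0 u h k = u ((j : ℝ) * h) := by
  induction k with
  | zero => left; rfl
  | succ k ih =>
    rcases max_choice (mseq m0 u h k) (u (((k + 1 : ℕ) : ℝ) * h)) with h1 | h1
    · rcases ih with h2 | ⟨j, hj, h2⟩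
      · left; exact h1.trans h2
      · right; exact ⟨j, by omega, h1.trans h2⟩
    · right; exact ⟨k + 1, le_rfl, h1⟩

lemma le_mseq (m0 : ℝ) (u : ℝ → ℝ) (h : ℝ) {j k : ℕ} (hj : 1 ≤ j) (hjk : j ≤ k) :
    u ((j : ℝ) * h) ≤ mseq m0 u h k := by
  refine le_trans ?_ (mseq_mono m0 u h hjk)
  obtain ⟨i, rfl⟩ : ∃ i, j = i + 1 := ⟨j - 1, by omega⟩
  exact le_max_right _ _

lemma mseq_doob {m0 : ℝ} {u : ℝ → ℝ} {h : ℝ} (hu0 : u 0 = 0) (k : ℕ) :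
    (mseq m0 u h k) ^ 2 / 2 + ∑ j ∈ Finset.range k,
      mseq m0 u h j * (u (((j + 1 : ℕ) : ℝ) * h) - u ((j : ℝ) * h)) ≤
    mseq m0 u h k * u ((k : ℝ) * h) + m0 ^ 2 / 2 := by
  induction k with
  | zero => simp [mseq, hu0]
  | succ k ih =>
    rw [Finset.sum_range_succ]
    have h1 : mseq m0 u h (k + 1) = max (mseq m0 u h k) (u (((k + 1 : ℕ) : ℝ) * h)) := rfl
    set a := mseq m0 u h k
    set b := u (((k + 1 : ℕ) : ℝ) * h)
    rw [h1]
    rcases max_cases a b with ⟨h2, h3⟩ | ⟨h2, h3⟩ <;> rw [h2]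
    · nlinarith
    · nlinarith [sq_nonneg (b - a)]

open Classical in
/-- Number of steps before the predicate fails. -/
noncomputable def cnt (p : ℕ → Prop) (N : ℕ) : ℕ := ((Finset.range N).filter p).card

open Classical in
lemma cnt_succ (p : ℕ → Prop) (N : ℕ) : cnt p (N + 1) = cnt p N + if p N then 1 else 0 := by
  unfold cnt
  rw [Finset.range_add_one, Finset.filter_insert]
  split_ifs with h
  · rw [Finset.card_insert_of_notMem (by simp)]
  · simp

lemma cnt_eq {p : ℕ → Prop} (hp : ∀ k, p (k + 1) → p k) (N : ℕ) (h : p N) : cnt p N = N := by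
  induction N with
  | zero => simp [cnt]
  | succ N ih => rw [cnt_succ, ih (hp _ h), if_pos (hp _ h)]

open Classical in
lemma cnt_le (p : ℕ → Prop) (N : ℕ) : cnt p N ≤ N := by
  unfold cnt
  exact (Finset.card_filter_le _ _).trans (by simp)

open Classical in
lemma cnt_sum {p : ℕ → Prop} (hp : ∀ k, p (k + 1) → p k) (f : ℕ → ℝ) (N : ℕ) :
    ∑ k ∈ Finset.range N, (if p k then (1:ℝ) else 0) * (f (k + 1) - f k) = f (cnt p N) - f 0 := by
  induction N with
  | zero => simp [cnt]
  | succ N ih =>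
    rw [Finset.sum_range_succ, ih, cnt_succ]
    split_ifs with h
    · rw [cnt_eq hp N h]; ring
    · simp

lemma cnt_spec_lt {p : ℕ → Prop} (hp : ∀ k, p (k + 1) → p k) (N : ℕ) (h : cnt p N < N) :
    ¬ p (cnt p N) := by
  induction N with
  | zero => omega
  | succ N ih =>
    rw [cnt_succ] at h ⊢
    split_ifs at h ⊢ with h1
    · rw [cnt_eq hp N h1] at h; omega
    · rw [add_zero] at h ⊢
      rcases (cnt_le p N).lt_or_eq with h2 | h2
      · exact ih h2
      · rwa [h2]

lemma cnt_spec_pos {p : ℕ → Prop} (hp : ∀ k, p (k + 1) → p k) (N : ℕ) (h : 0 < cnt p N) :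
    p (cnt p N - 1) := by
  induction N with
  | zero => simp [cnt] at h
  | succ N ih =>
    rw [cnt_succ] at h ⊢
    split_ifs at h ⊢ with h1
    · rw [cnt_eq hp N h1]; simpa using h1
    · rw [add_zero] at h ⊢
      exact ih h

/-- The key functional. -/
noncomputable def Jf (c m0 m u : ℝ) : ℝ := m / 2 - (m ^ 2 - m0 ^ 2) * gfun c u / 4

lemma boundary_nonneg {c m0 m u : ℝ} (hm0 : 0 < m0) (hm : m0 ≤ m) :
    0 ≤ (max m u - m) / 2 - ((max m u) ^ 2 - m ^ 2) * gfun c u / 4 := by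
  rcases max_cases m u with ⟨h2, h3⟩ | ⟨h2, h3⟩ <;> rw [h2]
  · simp
  · have hu : 0 < u := by linarith
    have h4 := gfun_le_inv (c := c) hu
    have h5 : (u ^ 2 - m ^ 2) * gfun c u ≤ (u ^ 2 - m ^ 2) * (1 / u) :=
      mul_le_mul_of_nonneg_left h4 (by nlinarith)
    have h6 : (u ^ 2 - m ^ 2) * (1 / u) ≤ 2 * (u - m) := by
      rw [mul_one_div, div_le_iff₀ hu]
      nlinarith [sq_nonneg (u - m)]
    linarith

lemma boundary_le {c m0 m u : ℝ} (hc : 0 < c) (hm0 : 0 < m0) (hm : m0 ≤ m) :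
    (max m u - m) / 2 - ((max m u) ^ 2 - m ^ 2) * gfun c u / 4 ≤
      (max m u - m) ^ 2 / (4 * m0) + exp (-(m0 / (2 * c))) / (4 * m0) * ((max m u) ^ 2 - m ^ 2) := by
  rcases max_cases m u with ⟨h2, h3⟩ | ⟨h2, h3⟩ <;> rw [h2]
  · simp
  · have hu : 0 < u := by linarith
    rw [gfun_of_pos hu]
    have he : exp (-(u / (2 * c))) ≤ exp (-(m0 / (2 * c))) := by
      rw [exp_le_exp]; gcongr; linarith
    have e1 : (u - m) / 2 - (u ^ 2 - m ^ 2) * ((1 - exp (-(u / (2 * c)))) / u) / 4 =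
      (u - m) ^ 2 / (4 * u) + exp (-(u / (2 * c))) / (4 * u) * (u ^ 2 - m ^ 2) := by
      field_simp; ring
    rw [e1]
    have h7 : 0 ≤ u ^ 2 - m ^ 2 := by nlinarith
    have h8 : m0 ≤ u := by linarith
    gcongr

lemma sum_sq_mono {a : ℕ → ℝ} (N : ℕ) : ∑ k ∈ Finset.range N, (a (k + 1) ^ 2 - a k ^ 2) = a N ^ 2 - a 0 ^ 2 :=
  Finset.sum_range_sub (fun k => a k ^ 2) N

/-- density: drawdown condition from rational fractions -/
lemma okDD_iff {lam t : ℝ} {u : ℝ → ℝ} (hu : Continuous u) (ht : 0 ≤ t) :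
    okDD lam u t ↔ ∀ N i j : ℕ, i ≤ j → j ≤ N + 1 →
      u (t * ((i : ℕ) / ((N : ℝ) + 1))) - u (t * ((j : ℕ) / ((N : ℝ) + 1))) ≤ lam := by
  constructor
  · intro h N i j hij hj
    refine h _ _ (by positivity) (by gcongr) ?_
    have : (j : ℝ) / ((N : ℝ) + 1) ≤ 1 := by
      rw [div_le_one (by positivity)]; exact_mod_cast hj
    nlinarith
  · intro h s r hs hsr hrt
    rcases ht.eq_or_lt with rfl | ht
    · have : s = 0 := by linarith
      have : r = 0 := by linarith
      subst_vars
      have := h 0 0 0 le_rfl (by norm_num)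
      simpa using this
    · have key : ∀ x : ℝ, 0 ≤ x → Tendsto (fun N : ℕ => t * ((⌊x / t * ((N:ℝ) + 1)⌋₊ : ℕ) / ((N : ℝ) + 1))) atTop (𝓝 x) := by
        intro x hx
        have h1 := tendsto_nat_floor_mul_div_atTop (R := ℝ) (a := x / t) (by positivity)
        have h2 : Tendsto (fun N : ℕ => (N : ℝ) + 1) atTop atTop :=
          tendsto_atTop_add_const_right _ _ tendsto_natCast_atTop_atTop
        have h3 := (h1.comp h2).const_mul t
        rw [mul_div_cancel₀ _ ht.ne'] at h3
        exact h3
      have hlim := ((hu.tendsto s).comp (key s hs)).sub ((hu.tendsto r).comp (key r (hs.trans hsr)))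
      refine le_of_tendsto' hlim fun N => ?_
      refine h N _ _ ?_ ?_
      · gcongr
      · refine Nat.floor_le_of_le ?_
        push_cast
        have : r / t ≤ 1 := (div_le_one ht).2 hrt
        have h0 : (0:ℝ) ≤ (N:ℝ) + 1 := by positivity
        nlinarith

open MeasureTheory ProbabilityTheory Real Set Filter
open scoped ENNReal Topology
set_option linter.unusedSectionVars false

/-- The squared norm path. -/
noncomputable def pth {Ω : Type*} (γ : ℝ → Ω → EuclideanSpace ℝ (Fin 4)) (ω : Ω) : ℝ → ℝ :=
  fun t => ‖γ t ω‖ ^ 2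

lemma meas_sq_aux {Ω : Type*} (m' : MeasurableSpace Ω) {f : Ω → EuclideanSpace ℝ (Fin 4)}
    (hf : Measurable[m'] f) : Measurable[m'] (fun ω => ‖f ω‖ ^ 2) := hf.norm.pow_const 2

lemma meas_max_aux {Ω : Type*} (m' : MeasurableSpace Ω) {f g : Ω → ℝ} (hf : Measurable[m'] f)
    (hg : Measurable[m'] g) : Measurable[m'] (fun ω => max (f ω) (g ω)) := hf.max hg

lemma meas_mul_aux {Ω : Type*} (m' : MeasurableSpace Ω) {f g : Ω → ℝ} (hf : Measurable[m'] f)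
    (hg : Measurable[m'] g) : Measurable[m'] (fun ω => f ω * g ω) := hf.mul hg

lemma meas_sqsub_aux {Ω : Type*} (m' : MeasurableSpace Ω) {f : Ω → ℝ} (a : ℝ) (hf : Measurable[m'] f) :
    Measurable[m'] (fun ω => f ω ^ 2 - a) := (hf.pow_const 2).sub_const a

lemma measSet_le_aux {Ω : Type*} (m' : MeasurableSpace Ω) {f g : Ω → ℝ} (a : ℝ) (hf : Measurable[m'] f)
    (hg : Measurable[m'] g) : MeasurableSet[m'] {ω | f ω - g ω ≤ a} :=
  measurableSet_le (hf.sub hg) measurable_const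

open Classical in
lemma meas_ite_aux {Ω : Type*} (m' : MeasurableSpace Ω) {p : Ω → Prop} (hp : MeasurableSet[m'] {ω | p ω}) :
    Measurable[m'] (fun ω => if p ω then (1:ℝ) else 0) :=
  Measurable.ite hp measurable_const measurable_const

section
variable {Ω : Type*} [m : MeasurableSpace Ω] {P : Measure Ω} [IsProbabilityMeasure P]
  {γ : ℝ → Ω → EuclideanSpace ℝ (Fin 4)}

lemma pth_cont (hγ : IsStdBMVec 4 P γ) (ω : Ω) : Continuous (pth γ ω) := by
  have : pth γ ω = fun t => ∑ i, (γ t ω i) ^ 2 := by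
    funext t; simp only [pth]; rw [EuclideanSpace.real_norm_sq_eq]
  rw [this]
  exact continuous_finsetSum _ fun i _ => ((hγ.coord i).cont ω).pow 2

lemma pth_zero (hγ : IsStdBMVec 4 P γ) (ω : Ω) : pth γ ω 0 = 0 := by
  simp only [pth]
  rw [EuclideanSpace.real_norm_sq_eq]
  refine Finset.sum_eq_zero fun i _ => ?_
  rw [(hγ.coord i).start ω]; simp

lemma pth_nonneg (γ : ℝ → Ω → EuclideanSpace ℝ (Fin 4)) (ω : Ω) (t : ℝ) : 0 ≤ pth γ ω t := by
  unfold pth; positivity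

lemma pth_meas (hγ : IsStdBMVec 4 P γ) (t : ℝ) : Measurable (fun ω => pth γ ω t) :=
  (BM_measurable hγ t).norm.pow_const 2

lemma pth_memLp (hγ : IsStdBMVec 4 P γ) {t : ℝ} (ht : 0 ≤ t) : MemLp (fun ω => pth γ ω t) 2 P :=
  U_memLp hγ ht

lemma pth_int (hγ : IsStdBMVec 4 P γ) {t : ℝ} (ht : 0 ≤ t) : Integrable (fun ω => pth γ ω t) P :=
  (pth_memLp hγ ht).integrable (by norm_num)

lemma okDD_meas (hγ : IsStdBMVec 4 P γ) (lam : ℝ) {t : ℝ} (ht : 0 ≤ t) :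
    MeasurableSet[pastF γ t] {ω | okDD lam (pth γ ω) t} := by
  have : {ω | okDD lam (pth γ ω) t} = ⋂ (N : ℕ), ⋂ (i : ℕ), ⋂ (j : ℕ), ⋂ (_ : i ≤ j), ⋂ (_ : j ≤ N + 1),
      {ω | pth γ ω (t * ((i : ℕ) / ((N : ℝ) + 1))) - pth γ ω (t * ((j : ℕ) / ((N : ℝ) + 1))) ≤ lam} := by
    ext ω
    simp only [mem_iInter]
    exact okDD_iff (pth_cont hγ ω) ht
  rw [this]
  refine MeasurableSet.iInter fun N => MeasurableSet.iInter fun i => MeasurableSet.iInter fun j =>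
    MeasurableSet.iInter fun hij => MeasurableSet.iInter fun hj => ?_
  exact measSet_le_aux _ lam (meas_sq_aux _ (measurable_pastF γ t i N (hij.trans hj)))
    (meas_sq_aux _ (measurable_pastF γ t j N hj))

lemma mseq_meas_past (γ : ℝ → Ω → EuclideanSpace ℝ (Fin 4)) (m0 h : ℝ) (k : ℕ) :
    Measurable[pastF γ ((k : ℝ) * h)] (fun ω => mseq m0 (pth γ ω) h k) := by
  have : ∀ j ≤ k, Measurable[pastF γ ((k : ℝ) * h)] (fun ω => mseq m0 (pth γ ω) h j) := by
    intro j
    induction j with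
    | zero => intro _; exact @measurable_const _ _ _ (pastF γ ((k : ℝ) * h)) m0
    | succ j ih =>
      intro hj
      refine meas_max_aux _ (ih (by omega)) ?_
      obtain ⟨n, rfl⟩ : ∃ n, k = n + 1 := ⟨k - 1, by omega⟩
      have h1 := meas_sq_aux _ (measurable_pastF γ (((n + 1 : ℕ) : ℝ) * h) (j + 1) n hj)
      have e : ((n + 1 : ℕ) : ℝ) * h * (((j + 1 : ℕ) : ℝ) / ((n : ℝ) + 1)) = ((j + 1 : ℕ) : ℝ) * h := by
        push_cast; field_simp
      rw [e] at h1
      exact h1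
  exact this k le_rfl

lemma mseq_meas (hγ : IsStdBMVec 4 P γ) (m0 h : ℝ) (k : ℕ) :
    Measurable (fun ω => mseq m0 (pth γ ω) h k) :=
  (mseq_meas_past γ m0 h k).mono (pastF_le hγ _) le_rfl

lemma mseq_memLp (hγ : IsStdBMVec 4 P γ) (m0 : ℝ) {h : ℝ} (hh : 0 ≤ h) (k : ℕ) :
    MemLp (fun ω => mseq m0 (pth γ ω) h k) 2 P := by
  induction k with
  | zero => exact memLp_const m0
  | succ k ih => exact ih.sup (pth_memLp hγ (by positivity))

lemma step_U (hγ : IsStdBMVec 4 P γ) {t r : ℝ} (ht : 0 ≤ t) (htr : t ≤ r) {Y : Ω → ℝ}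
    (hY : Measurable[pastF γ t] Y) (hY2 : MemLp Y 2 P) :
    ∫ ω, Y ω * (pth γ ω r - pth γ ω t) ∂P = 4 * (r - t) * ∫ ω, Y ω ∂P := by
  have hr : 0 ≤ r := ht.trans htr
  have i1 : Integrable (fun ω => Y ω * pth γ ω r) P := hY2.integrable_mul (pth_memLp hγ hr)
  have i2 : Integrable (fun ω => Y ω * pth γ ω t) P := hY2.integrable_mul (pth_memLp hγ ht)
  have i3 : Integrable Y P := hY2.integrable (by norm_num)
  have e := freeze hγ ht htr hY (G := fun x => ‖x‖ ^ 2) (by fun_prop) i1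
  simp_rw [incr_sq hγ ht htr] at e
  simp_rw [mul_sub]
  rw [integral_sub i1 i2]
  have e1 : ∫ ω, Y ω * pth γ ω r ∂P = ∫ ω, (Y ω * pth γ ω t + 4 * (r - t) * Y ω) ∂P := by
    refine e.trans (integral_congr_ae (Eventually.of_forall fun ω => ?_))
    simp only [pth]; ring
  rw [e1, integral_add i2 (i3.const_mul _), integral_const_mul]
  ring

lemma gfun_pth_abs {c : ℝ} (hc : 0 < c) (ω : Ω) (t : ℝ) : ‖gfun c (pth γ ω t)‖ ≤ 1 / (2 * c) := by
  rw [Real.norm_eq_abs, abs_of_nonneg (gfun_nonneg hc _)]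
  exact gfun_le hc (pth_nonneg γ ω t)

lemma gfun_pth_int (hγ : IsStdBMVec 4 P γ) {c : ℝ} (hc : 0 < c) (t : ℝ) {Y : Ω → ℝ}
    (hY : Integrable Y P) : Integrable (fun ω => Y ω * gfun c (pth γ ω t)) P :=
  hY.mul_bdd (c := 1 / (2 * c)) ((gfun_continuous c).measurable.comp (pth_meas hγ t)).aestronglyMeasurable
    (Eventually.of_forall fun ω => gfun_pth_abs hc ω t)

lemma step_g (hγ : IsStdBMVec 4 P γ) {t r c : ℝ} (ht : 0 ≤ t) (htr : t < r) (hc : 0 < c) {Y : Ω → ℝ}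
    (hY : Measurable[pastF γ t] Y) (hYi : Integrable Y P) :
    ∫ ω, Y ω * (gfun c (pth γ ω r) - gfun c (pth γ ω t)) ∂P =
      - ∫ ω, Y ω * (gfun c (pth γ ω t) - gfun (c + (r - t)) (pth γ ω t)) ∂P := by
  have hh : 0 < c + (r - t) := by linarith
  have i1 := gfun_pth_int hγ hc r hYi
  have i2 := gfun_pth_int hγ hc t hYi
  have i3 := gfun_pth_int hγ hh t hYi
  have e := freeze hγ ht htr.le hY (G := fun x => gfun c (‖x‖ ^ 2))
    ((gfun_continuous c).measurable.comp (by fun_prop)) i1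
  simp_rw [gfun_heat hγ ht htr hc] at e
  simp_rw [mul_sub]
  rw [integral_sub i1 i2, integral_sub i2 i3]
  have e1 : ∫ ω, Y ω * gfun c (pth γ ω r) ∂P = ∫ ω, Y ω * gfun (c + (r - t)) (pth γ ω t) ∂P := e
  rw [e1]; ring

lemma doob (hγ : IsStdBMVec 4 P γ) {m0 : ℝ} (hm0 : 0 ≤ m0) {h : ℝ} (hh : 0 ≤ h) (N : ℕ) :
    ∫ ω, (mseq m0 (pth γ ω) h N) ^ 2 ∂P ≤ 4 * ∫ ω, (pth γ ω (N * h)) ^ 2 ∂P + 2 * m0 ^ 2 := by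
  have hm : ∀ k, MemLp (fun ω => mseq m0 (pth γ ω) h k) 2 P := mseq_memLp hγ m0 hh
  have hnn : ∀ k ω, 0 ≤ mseq m0 (pth γ ω) h k := fun k ω => hm0.trans (mseq_ge _ _ _ _)
  have hs : ∀ j : ℕ, 0 ≤ ∫ ω, mseq m0 (pth γ ω) h j * (pth γ ω (((j + 1 : ℕ) : ℝ) * h) - pth γ ω ((j : ℝ) * h)) ∂P := by
    intro j
    have hle : (j : ℝ) * h ≤ ((j + 1 : ℕ) : ℝ) * h := by push_cast; nlinarith
    rw [step_U hγ (by positivity) hle (mseq_meas_past γ m0 h j) (hm j)]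
    have : 0 ≤ ∫ ω, mseq m0 (pth γ ω) h j ∂P := integral_nonneg (hnn j)
    have : 0 ≤ ((j + 1 : ℕ) : ℝ) * h - j * h := by linarith
    positivity
  have hi : ∀ j : ℕ, Integrable (fun ω => mseq m0 (pth γ ω) h j * (pth γ ω (((j + 1 : ℕ) : ℝ) * h) - pth γ ω ((j : ℝ) * h))) P :=
    fun j => (hm j).integrable_mul ((pth_memLp hγ (by positivity)).sub (pth_memLp hγ (by positivity)))
  have i1 : Integrable (fun ω => (mseq m0 (pth γ ω) h N) ^ 2) P := (hm N).integrable_sq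
  have i2 : Integrable (fun ω => (pth γ ω (N * h)) ^ 2) P := (pth_memLp hγ (by positivity)).integrable_sq
  have i3 : Integrable (fun ω => (pth γ ω (N * h)) ^ 2 + m0 ^ 2 / 2) P := i2.add (integrable_const _)
  have key : ∫ ω, ((mseq m0 (pth γ ω) h N) ^ 2 / 2 + ∑ j ∈ Finset.range N,
      mseq m0 (pth γ ω) h j * (pth γ ω (((j + 1 : ℕ) : ℝ) * h) - pth γ ω ((j : ℝ) * h))) ∂P ≤
      ∫ ω, ((mseq m0 (pth γ ω) h N) ^ 2 / 4 + ((pth γ ω (N * h)) ^ 2 + m0 ^ 2 / 2)) ∂P := by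
    refine integral_mono ((i1.div_const 2).add (integrable_finsetSum _ fun j _ => hi j))
      ((i1.div_const 4).add (i2.add (integrable_const _))) fun ω => ?_
    have := mseq_doob (m0 := m0) (h := h) (pth_zero hγ ω) N
    refine this.trans ?_
    nlinarith [sq_nonneg (mseq m0 (pth γ ω) h N / 2 - pth γ ω (N * h))]
  rw [integral_add (i1.div_const 2) (integrable_finsetSum _ fun j _ => hi j),
    integral_finsetSum _ (fun j _ => hi j), integral_add (i1.div_const 4) i3,
    integral_add i2 (integrable_const _), integral_div, integral_div] at key
  have h0 := Finset.sum_nonneg (fun j (_ : j ∈ Finset.range N) => hs j)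
  simp only [integral_const, probReal_univ, smul_eq_mul, one_mul] at key
  linarith

end

open MeasureTheory ProbabilityTheory Real Set Filter
open scoped ENNReal Topology
set_option linter.unusedSectionVars false

open Classical in
/-- indicator of no large drawdown up to step `k` -/
noncomputable def Ik {Ω : Type*} (γ : ℝ → Ω → EuclideanSpace ℝ (Fin 4)) (lam h : ℝ) (k : ℕ) (ω : Ω) : ℝ :=
  if okDD lam (pth γ ω) ((k : ℝ) * h) then 1 else 0

/-- discrete stopping index -/
noncomputable def sg {Ω : Type*} (γ : ℝ → Ω → EuclideanSpace ℝ (Fin 4)) (lam h : ℝ) (N : ℕ) (ω : Ω) : ℕ :=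
  cnt (fun k => okDD lam (pth γ ω) ((k : ℝ) * h)) N

section
variable {Ω : Type*} [m : MeasurableSpace Ω] {P : Measure Ω} [IsProbabilityMeasure P]
  {γ : ℝ → Ω → EuclideanSpace ℝ (Fin 4)}

lemma okDD_step {lam h : ℝ} (hh : 0 ≤ h) (ω : Ω) : ∀ k : ℕ,
    okDD lam (pth γ ω) (((k + 1 : ℕ) : ℝ) * h) → okDD lam (pth γ ω) ((k : ℝ) * h) :=
  fun k => okDD_mono (by push_cast; nlinarith)

lemma sg_sum {lam h : ℝ} (hh : 0 ≤ h) (ω : Ω) (f : ℕ → ℝ) (N : ℕ) :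
    f (sg γ lam h N ω) = f 0 + ∑ k ∈ Finset.range N, Ik γ lam h k ω * (f (k + 1) - f k) := by
  have := cnt_sum (p := fun k => okDD lam (pth γ ω) ((k : ℝ) * h)) (okDD_step hh ω) f N
  unfold sg Ik
  rw [this]; ring

lemma Ik_nonneg (lam h : ℝ) (k : ℕ) (ω : Ω) : 0 ≤ Ik γ lam h k ω := by
  unfold Ik; split_ifs <;> norm_num

lemma Ik_le (lam h : ℝ) (k : ℕ) (ω : Ω) : Ik γ lam h k ω ≤ 1 := by
  unfold Ik; split_ifs <;> norm_num

lemma Ik_meas_past (hγ : IsStdBMVec 4 P γ) (lam : ℝ) {h : ℝ} (hh : 0 ≤ h) (k : ℕ) :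
    Measurable[pastF γ ((k : ℝ) * h)] (Ik γ lam h k) :=
  meas_ite_aux _ (okDD_meas hγ lam (by positivity))

lemma Ik_meas (hγ : IsStdBMVec 4 P γ) (lam : ℝ) {h : ℝ} (hh : 0 ≤ h) (k : ℕ) :
    Measurable (Ik γ lam h k) :=
  (Ik_meas_past hγ lam hh k).mono (pastF_le hγ _) le_rfl

lemma Ik_norm (lam h : ℝ) (k : ℕ) (ω : Ω) : ‖Ik γ lam h k ω‖ ≤ 1 := by
  rw [Real.norm_eq_abs, abs_of_nonneg (Ik_nonneg _ _ _ _)]; exact Ik_le _ _ _ _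

lemma Ik_memLp (hγ : IsStdBMVec 4 P γ) (lam : ℝ) {h : ℝ} (hh : 0 ≤ h) (k : ℕ) :
    MemLp (Ik γ lam h k) 2 P :=
  MemLp.of_bound (Ik_meas hγ lam hh k).aestronglyMeasurable 1 (Eventually.of_forall (Ik_norm lam h k))

lemma Ik_mul_int (hγ : IsStdBMVec 4 P γ) (lam : ℝ) {h : ℝ} (hh : 0 ≤ h) (k : ℕ) {f : Ω → ℝ}
    (hf : Integrable f P) : Integrable (fun ω => Ik γ lam h k ω * f ω) P :=
  hf.bdd_mul (c := 1) (Ik_meas hγ lam hh k).aestronglyMeasurable (Eventually.of_forall (Ik_norm lam h k))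

lemma sg_meas (hγ : IsStdBMVec 4 P γ) (lam : ℝ) {h : ℝ} (hh : 0 ≤ h) (N : ℕ) {F : ℕ → Ω → ℝ}
    (hF : ∀ k, Measurable (F k)) : Measurable (fun ω => F (sg γ lam h N ω) ω) := by
  have : (fun ω => F (sg γ lam h N ω) ω) = fun ω => F 0 ω + ∑ k ∈ Finset.range N, Ik γ lam h k ω * (F (k + 1) ω - F k ω) := by
    funext ω; exact sg_sum hh ω (fun k => F k ω) N
  rw [this]
  exact (hF 0).add (Finset.measurable_sum _ fun k _ => (Ik_meas hγ lam hh k).mul ((hF _).sub (hF _)))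

lemma sg_integral (hγ : IsStdBMVec 4 P γ) (lam : ℝ) {h : ℝ} (hh : 0 ≤ h) (N : ℕ) {F : ℕ → Ω → ℝ}
    (hF : ∀ k, Integrable (F k) P) : ∫ ω, F (sg γ lam h N ω) ω ∂P =
      ∫ ω, F 0 ω ∂P + ∑ k ∈ Finset.range N, ∫ ω, Ik γ lam h k ω * (F (k + 1) ω - F k ω) ∂P := by
  have : (fun ω => F (sg γ lam h N ω) ω) = fun ω => F 0 ω + ∑ k ∈ Finset.range N, Ik γ lam h k ω * (F (k + 1) ω - F k ω) := by
    funext ω; exact sg_sum hh ω (fun k => F k ω) N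
  have hi : ∀ k, Integrable (fun ω => Ik γ lam h k ω * (F (k + 1) ω - F k ω)) P := fun k =>
    Ik_mul_int hγ lam hh k ((hF _).sub (hF _))
  rw [this, integral_add (hF 0) (integrable_finsetSum _ fun k _ => hi k), integral_finsetSum _ fun k _ => hi k]

lemma disc_U (hγ : IsStdBMVec 4 P γ) (lam : ℝ) {h : ℝ} (hh : 0 ≤ h) (N : ℕ) :
    ∫ ω, pth γ ω ((sg γ lam h N ω : ℝ) * h) ∂P = 4 * ∫ ω, (sg γ lam h N ω : ℝ) * h ∂P := by
  rw [sg_integral hγ lam hh N (F := fun k ω => pth γ ω ((k : ℝ) * h)) (fun k => pth_int hγ (by positivity)),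
    sg_integral hγ lam hh N (F := fun k ω => (k : ℝ) * h) (fun k => integrable_const _)]
  have h0 : ∫ ω, pth γ ω (((0 : ℕ) : ℝ) * h) ∂P = 0 := by
    simp [pth_zero hγ]
  have h1 : ∫ ω : Ω, ((0 : ℕ) : ℝ) * h ∂P = 0 := by simp
  rw [h0, h1, zero_add, zero_add, Finset.mul_sum]
  refine Finset.sum_congr rfl fun k _ => ?_
  rw [step_U hγ (by positivity) (by push_cast; nlinarith) (Ik_meas_past hγ lam hh k) (Ik_memLp hγ lam hh k),
    integral_mul_const]
  ring

lemma J_int (hγ : IsStdBMVec 4 P γ) {c m0 : ℝ} (hc : 0 < c) {h : ℝ} (hh : 0 ≤ h) (k : ℕ) :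
    Integrable (fun ω => Jf c m0 (mseq m0 (pth γ ω) h k) (pth γ ω ((k:ℝ) * h))) P := by
  have hm := mseq_memLp hγ m0 hh k
  have h1 : Integrable (fun ω => mseq m0 (pth γ ω) h k) P := hm.integrable (by norm_num)
  have h2 : Integrable (fun ω => (mseq m0 (pth γ ω) h k) ^ 2 - m0 ^ 2) P :=
    hm.integrable_sq.sub (integrable_const _)
  exact (h1.div_const 2).sub ((gfun_pth_int hγ hc _ h2).div_const 4)

/-- boundary increment -/
noncomputable def bdry (c m u : ℝ) : ℝ := (max m u - m) / 2 - ((max m u) ^ 2 - m ^ 2) * gfun c u / 4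

lemma J_step (hγ : IsStdBMVec 4 P γ) {c m0 lam : ℝ} (hc : 0 < c) {h : ℝ} (hh : 0 < h) (k : ℕ) :
    Integrable (fun ω => Ik γ lam h k ω * bdry c (mseq m0 (pth γ ω) h k) (pth γ ω (((k + 1 : ℕ):ℝ) * h))) P ∧
    Integrable (fun ω => Ik γ lam h k ω * (((mseq m0 (pth γ ω) h k) ^ 2 - m0 ^ 2) *
        (gfun c (pth γ ω ((k:ℝ) * h)) - gfun (c + h) (pth γ ω ((k:ℝ) * h))))) P ∧
    ∫ ω, Ik γ lam h k ω * (Jf c m0 (mseq m0 (pth γ ω) h (k + 1)) (pth γ ω (((k + 1 : ℕ):ℝ) * h)) -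
      Jf c m0 (mseq m0 (pth γ ω) h k) (pth γ ω ((k:ℝ) * h))) ∂P =
    ∫ ω, Ik γ lam h k ω * bdry c (mseq m0 (pth γ ω) h k) (pth γ ω (((k + 1 : ℕ):ℝ) * h)) ∂P +
      (∫ ω, Ik γ lam h k ω * (((mseq m0 (pth γ ω) h k) ^ 2 - m0 ^ 2) *
        (gfun c (pth γ ω ((k:ℝ) * h)) - gfun (c + h) (pth γ ω ((k:ℝ) * h)))) ∂P) / 4 := by
  have hm := mseq_memLp hγ m0 hh.le k
  have h2 : Integrable (fun ω => (mseq m0 (pth γ ω) h k) ^ 2 - m0 ^ 2) P :=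
    hm.integrable_sq.sub (integrable_const _)
  have hch : 0 < c + h := by linarith
  set Y : Ω → ℝ := fun ω => Ik γ lam h k ω * ((mseq m0 (pth γ ω) h k) ^ 2 - m0 ^ 2) with hYdef
  have hYi : Integrable Y P := Ik_mul_int hγ lam hh.le k h2
  have hYm : Measurable[pastF γ ((k : ℝ) * h)] Y :=
    meas_mul_aux _ (Ik_meas_past hγ lam hh.le k) (meas_sqsub_aux _ _ (mseq_meas_past γ m0 h k))
  have st := step_g hγ (t := (k:ℝ) * h) (r := ((k + 1 : ℕ):ℝ) * h) (by positivity)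
    (by push_cast; nlinarith) hc hYm hYi
  have e : ((k + 1 : ℕ):ℝ) * h - (k:ℝ) * h = h := by push_cast; ring
  rw [e] at st
  have iA := gfun_pth_int hγ hc (((k + 1 : ℕ):ℝ) * h) hYi
  have iB := gfun_pth_int hγ hc ((k:ℝ) * h) hYi
  have iC := gfun_pth_int hγ hch ((k:ℝ) * h) hYi
  have iJ := Ik_mul_int hγ lam hh.le k ((J_int hγ (m0 := m0) hc hh.le (k + 1)).sub (J_int hγ (m0 := m0) hc hh.le k))
  have iAB : Integrable (fun ω => Y ω * (gfun c (pth γ ω (((k + 1 : ℕ):ℝ) * h)) - gfun c (pth γ ω ((k:ℝ) * h)))) P := by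
    simp only [mul_sub]; exact iA.sub iB
  have iBC : Integrable (fun ω => Y ω * (gfun c (pth γ ω ((k:ℝ) * h)) - gfun (c + h) (pth γ ω ((k:ℝ) * h)))) P := by
    simp only [mul_sub]; exact iB.sub iC
  have ibd : Integrable (fun ω => Ik γ lam h k ω * bdry c (mseq m0 (pth γ ω) h k) (pth γ ω (((k + 1 : ℕ):ℝ) * h))) P := by
    refine (iJ.add (iAB.div_const 4)).congr (Eventually.of_forall fun ω => ?_)
    have hm1 : mseq m0 (pth γ ω) h (k + 1) = max (mseq m0 (pth γ ω) h k) (pth γ ω (((k + 1 : ℕ):ℝ) * h)) := rfl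
    simp only [Pi.add_apply, Pi.sub_apply, hYdef, bdry, Jf, hm1]
    ring
  refine ⟨ibd, by simpa only [hYdef, mul_assoc] using iBC, ?_⟩
  have e2 : ∫ ω, Ik γ lam h k ω * (Jf c m0 (mseq m0 (pth γ ω) h (k + 1)) (pth γ ω (((k + 1 : ℕ):ℝ) * h)) -
      Jf c m0 (mseq m0 (pth γ ω) h k) (pth γ ω ((k:ℝ) * h))) ∂P =
    ∫ ω, (Ik γ lam h k ω * bdry c (mseq m0 (pth γ ω) h k) (pth γ ω (((k + 1 : ℕ):ℝ) * h)) -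
      Y ω * (gfun c (pth γ ω (((k + 1 : ℕ):ℝ) * h)) - gfun c (pth γ ω ((k:ℝ) * h))) / 4) ∂P := by
    refine integral_congr_ae (Eventually.of_forall fun ω => ?_)
    have hm1 : mseq m0 (pth γ ω) h (k + 1) = max (mseq m0 (pth γ ω) h k) (pth γ ω (((k + 1 : ℕ):ℝ) * h)) := rfl
    simp only [hYdef, bdry, Jf, hm1]
    ring
  rw [e2, integral_sub ibd (iAB.div_const 4), integral_div, st]
  simp only [hYdef, mul_assoc]
  ring

lemma J0_int_eq {c m0 h : ℝ} : ∫ ω, Jf c m0 (mseq m0 (pth γ ω) h 0) (pth γ ω (((0:ℕ):ℝ) * h)) ∂P = m0 / 2 := by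
  simp [Jf, mseq]

lemma disc_J_lower (hγ : IsStdBMVec 4 P γ) {c m0 : ℝ} (lam : ℝ) (hc : 0 < c) (hm0 : 0 < m0) {h : ℝ} (hh : 0 < h) (N : ℕ) :
    m0 / 2 ≤ ∫ ω, Jf c m0 (mseq m0 (pth γ ω) h (sg γ lam h N ω)) (pth γ ω ((sg γ lam h N ω : ℝ) * h)) ∂P := by
  rw [sg_integral hγ lam hh.le N (F := fun k ω => Jf c m0 (mseq m0 (pth γ ω) h k) (pth γ ω ((k:ℝ) * h)))
    (fun k => J_int hγ hc hh.le k), J0_int_eq]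
  refine le_add_of_nonneg_right (Finset.sum_nonneg fun k _ => ?_)
  obtain ⟨-, -, e⟩ := J_step hγ (m0 := m0) (lam := lam) hc hh k
  rw [e]
  refine add_nonneg (integral_nonneg fun ω => ?_) (div_nonneg (integral_nonneg fun ω => ?_) (by norm_num))
  · exact mul_nonneg (Ik_nonneg _ _ _ _) (boundary_nonneg hm0 (mseq_ge _ _ _ _))
  · refine mul_nonneg (Ik_nonneg _ _ _ _) (mul_nonneg ?_ (gfun_sub_nonneg hc hh.le _))
    have := mseq_ge m0 (pth γ ω) h k
    nlinarith

lemma disc_J_upper (hγ : IsStdBMVec 4 P γ) {c m0 lam : ℝ} (hc : 0 < c) (hm0 : 0 < m0) {h : ℝ} (hh : 0 < h)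
    (hhc : h ≤ c) (hlam : lam < m0) (N : ℕ) :
    ∫ ω, Jf c m0 (mseq m0 (pth γ ω) h (sg γ lam h N ω)) (pth γ ω ((sg γ lam h N ω : ℝ) * h)) ∂P ≤
      m0 / 2 + (1 / (4 * m0)) * ∫ ω, ∑ k ∈ Finset.range N, (mseq m0 (pth γ ω) h (k + 1) - mseq m0 (pth γ ω) h k) ^ 2 ∂P
      + (exp (-(m0 / (2 * c))) / (4 * m0) + N * h / (8 * c ^ 2) * exp (-((m0 - lam) / (4 * c)))) *
        ∫ ω, (mseq m0 (pth γ ω) h N) ^ 2 ∂P := by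
  have hm := fun k => mseq_memLp hγ m0 hh.le k
  have hsq : ∀ k, Integrable (fun ω => (mseq m0 (pth γ ω) h k) ^ 2) P := fun k => (hm k).integrable_sq
  have hdsq : ∀ k, Integrable (fun ω => (mseq m0 (pth γ ω) h (k + 1) - mseq m0 (pth γ ω) h k) ^ 2) P :=
    fun k => ((hm (k + 1)).sub (hm k)).integrable_sq
  rw [sg_integral hγ lam hh.le N (F := fun k ω => Jf c m0 (mseq m0 (pth γ ω) h k) (pth γ ω ((k:ℝ) * h)))
    (fun k => J_int hγ hc hh.le k), J0_int_eq]
  set E := exp (-(m0 / (2 * c))) / (4 * m0)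
  set D := h / (8 * c ^ 2) * exp (-((m0 - lam) / (4 * c)))
  set q := ∫ ω, (mseq m0 (pth γ ω) h N) ^ 2 ∂P
  have hE : 0 ≤ E := by positivity
  have hD : 0 ≤ D := by positivity
  have step : ∀ k ∈ Finset.range N, ∫ ω, Ik γ lam h k ω * (Jf c m0 (mseq m0 (pth γ ω) h (k + 1)) (pth γ ω (((k + 1 : ℕ):ℝ) * h)) -
      Jf c m0 (mseq m0 (pth γ ω) h k) (pth γ ω ((k:ℝ) * h))) ∂P ≤
      (1 / (4 * m0)) * ∫ ω, (mseq m0 (pth γ ω) h (k + 1) - mseq m0 (pth γ ω) h k) ^ 2 ∂P +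
      E * (∫ ω, (mseq m0 (pth γ ω) h (k + 1)) ^ 2 ∂P - ∫ ω, (mseq m0 (pth γ ω) h k) ^ 2 ∂P) + D * q := by
    intro k hk
    obtain ⟨i1, i2, e⟩ := J_step hγ (m0 := m0) (lam := lam) hc hh k
    rw [e]
    refine add_le_add ?_ ?_
    · have hss : Integrable (fun ω => (mseq m0 (pth γ ω) h (k + 1)) ^ 2 - (mseq m0 (pth γ ω) h k) ^ 2) P :=
        (hsq _).sub (hsq _)
      rw [← integral_const_mul, ← integral_sub (hsq _) (hsq _), ← integral_const_mul,
        ← integral_add ((hdsq k).const_mul _) (hss.const_mul _)]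
      refine integral_mono i1 (((hdsq k).const_mul _).add (hss.const_mul _)) fun ω => ?_
      have hb0 := boundary_nonneg (c := c) (u := pth γ ω (((k + 1 : ℕ):ℝ) * h)) hm0 (mseq_ge m0 (pth γ ω) h k)
      have hb1 := boundary_le (u := pth γ ω (((k + 1 : ℕ):ℝ) * h)) hc hm0 (mseq_ge m0 (pth γ ω) h k)
      have hI := Ik_le (γ := γ) lam h k ω
      have : Ik γ lam h k ω * bdry c (mseq m0 (pth γ ω) h k) (pth γ ω (((k + 1 : ℕ):ℝ) * h)) ≤
        bdry c (mseq m0 (pth γ ω) h k) (pth γ ω (((k + 1 : ℕ):ℝ) * h)) :=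
        mul_le_of_le_one_left hb0 hI
      refine this.trans (hb1.trans (le_of_eq ?_))
      have hm1 : mseq m0 (pth γ ω) h (k + 1) = max (mseq m0 (pth γ ω) h k) (pth γ ω (((k + 1 : ℕ):ℝ) * h)) := rfl
      simp only [hm1]
      ring
    · rw [div_le_iff₀ (by norm_num), mul_right_comm, ← integral_const_mul]
      refine integral_mono i2 ((hsq _).const_mul _) fun ω => ?_
      have hmN : mseq m0 (pth γ ω) h k ≤ mseq m0 (pth γ ω) h N :=
        mseq_mono _ _ _ (Finset.mem_range.1 hk).le
      have hm1 := mseq_ge m0 (pth γ ω) h k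
      set a := mseq m0 (pth γ ω) h k with ha
      set b := mseq m0 (pth γ ω) h N
      have hRHS : 0 ≤ D * 4 * b ^ 2 := by positivity
      simp only
      unfold Ik
      split_ifs with hok
      · rw [one_mul]
        rcases hm1.eq_or_lt with h1 | h1
        · rw [← h1]; simpa using hRHS
        · rcases mseq_cases m0 (pth γ ω) h k with h2 | ⟨j, hj, h2⟩
          · exact absurd h2 h1.ne'
          · have h3 := hok ((j:ℝ) * h) ((k:ℝ) * h) (by positivity) (by gcongr) le_rfl
            rw [← h2, ← ha] at h3
            have hu : m0 - lam ≤ pth γ ω ((k:ℝ) * h) := by linarith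
            have hg := gfun_sub_le hc hh.le (pth_nonneg γ ω ((k:ℝ) * h))
            have he : exp (-(pth γ ω ((k:ℝ) * h) / (2 * (c + h)))) ≤ exp (-((m0 - lam) / (4 * c))) := by
              rw [exp_le_exp, neg_le_neg_iff]
              have : 2 * (c + h) ≤ 4 * c := by linarith
              have h0 : 0 < m0 - lam := by linarith
              have : 0 < 2 * (c + h) := by linarith
              have := pth_nonneg γ ω ((k:ℝ) * h)
              gcongr
            have hg0 := gfun_sub_nonneg hc hh.le (pth γ ω ((k:ℝ) * h))
            have hg2 : gfun c (pth γ ω ((k:ℝ) * h)) - gfun (c + h) (pth γ ω ((k:ℝ) * h)) ≤ D * 4 := by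
              refine hg.trans ?_
              calc _ ≤ h / (2 * c ^ 2) * exp (-((m0 - lam) / (4 * c))) := by gcongr
                _ = D * 4 := by simp only [D]; ring
            have hsqab : a ^ 2 - m0 ^ 2 ≤ b ^ 2 := by nlinarith
            calc _ ≤ b ^ 2 * (D * 4) := mul_le_mul hsqab hg2 hg0 (by positivity)
              _ = _ := by ring
      · simpa using hRHS
  have hsum := Finset.sum_le_sum step
  have e3 : ∑ k ∈ Finset.range N, (∫ ω, (mseq m0 (pth γ ω) h (k + 1)) ^ 2 ∂P - ∫ ω, (mseq m0 (pth γ ω) h k) ^ 2 ∂P)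
      = q - m0 ^ 2 := by
    rw [Finset.sum_range_sub (fun k => ∫ ω, (mseq m0 (pth γ ω) h k) ^ 2 ∂P)]
    simp [mseq, q]
  rw [Finset.sum_add_distrib, Finset.sum_add_distrib, ← Finset.mul_sum, ← Finset.mul_sum, e3,
    Finset.sum_const, Finset.card_range, nsmul_eq_mul, ← integral_finsetSum _ fun k _ => hdsq k] at hsum
  have e4 : (N:ℝ) * (D * q) = (N * h / (8 * c ^ 2) * exp (-((m0 - lam) / (4 * c)))) * q := by
    simp only [D]; ring
  rw [e4] at hsum
  have : 0 ≤ E * m0 ^ 2 := by positivity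
  linarith
end

open MeasureTheory ProbabilityTheory Real Set Filter
open scoped ENNReal Topology
set_option linter.unusedSectionVars false

/-- Last time up to `T` with drawdown at most `lam`. -/
noncomputable def stp (lam T : ℝ) (u : ℝ → ℝ) : ℝ := sSup {t | t ∈ Icc 0 T ∧ okDD lam u t}

lemma okDD_zero {lam : ℝ} (hl : 0 ≤ lam) (u : ℝ → ℝ) : okDD lam u 0 := by
  intro s r hs hsr hr
  have : s = 0 := by linarith
  have : r = 0 := by linarith
  subst_vars; simpa using hl

lemma stp_bdd (lam T : ℝ) (u : ℝ → ℝ) : BddAbove {t | t ∈ Icc 0 T ∧ okDD lam u t} :=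
  ⟨T, fun _ ht => ht.1.2⟩

lemma stp_nonempty {lam T : ℝ} (hl : 0 ≤ lam) (hT : 0 ≤ T) (u : ℝ → ℝ) :
    {t | t ∈ Icc 0 T ∧ okDD lam u t}.Nonempty := ⟨0, ⟨le_rfl, hT⟩, okDD_zero hl u⟩

lemma le_stp {lam T : ℝ} {u : ℝ → ℝ} {t : ℝ} (h0 : 0 ≤ t) (hT : t ≤ T) (h : okDD lam u t) : t ≤ stp lam T u :=
  le_csSup (stp_bdd _ _ _) ⟨⟨h0, hT⟩, h⟩

lemma stp_nonneg {lam T : ℝ} (hl : 0 ≤ lam) (hT : 0 ≤ T) (u : ℝ → ℝ) : 0 ≤ stp lam T u :=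
  le_stp le_rfl hT (okDD_zero hl u)

lemma stp_le {lam T : ℝ} (hl : 0 ≤ lam) (hT : 0 ≤ T) (u : ℝ → ℝ) : stp lam T u ≤ T :=
  csSup_le (stp_nonempty hl hT u) fun _ ht => ht.1.2

lemma stp_ok {lam T : ℝ} (hl : 0 ≤ lam) (hT : 0 ≤ T) {u : ℝ → ℝ} (hu : Continuous u) :
    okDD lam u (stp lam T u) := by
  have key : ∀ s r, 0 ≤ s → s ≤ r → r < stp lam T u → u s - u r ≤ lam := by
    intro s r hs hsr hr
    obtain ⟨t, ht, hrt⟩ := exists_lt_of_lt_csSup (stp_nonempty hl hT u) hr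
    exact ht.2 s r hs hsr hrt.le
  intro s r hs hsr hr
  rcases hr.lt_or_eq with hr | hr
  · exact key s r hs hsr hr
  · rcases hsr.lt_or_eq with hsr | rfl
    · have hlim : Tendsto (fun x => u s - u x) (𝓝[<] r) (𝓝 (u s - u r)) :=
        ((continuous_const.sub hu).tendsto r).mono_left nhdsWithin_le_nhds
      refine le_of_tendsto hlim ?_
      filter_upwards [Ioo_mem_nhdsLT hsr] with x hx
      exact key s x hs hx.1.le (hr ▸ hx.2)
    · simpa using hl

/-- running maximum -/
noncomputable def rmx (u : ℝ → ℝ) (t : ℝ) : ℝ := sSup ((fun x => u (t * x)) '' Icc 0 1)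

lemma rmx_cont {u : ℝ → ℝ} (hu : Continuous u) : Continuous (rmx u) :=
  isCompact_Icc.continuous_sSup (f := fun t x => u (t * x)) (by
    show Continuous fun p : ℝ × ℝ => u (p.1 * p.2)
    fun_prop)

lemma rmx_image {u : ℝ → ℝ} {t : ℝ} (ht : 0 ≤ t) : (fun x => u (t * x)) '' Icc 0 1 = u '' Icc 0 t := by
  have : (fun x => u (t * x)) = u ∘ (fun x => t * x) := rfl
  rw [this, image_comp]
  congr 1
  rcases ht.eq_or_lt with rfl | ht
  · ext x; simp only [zero_mul, mem_image, mem_Icc]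
    constructor
    · rintro ⟨_, _, rfl⟩; exact ⟨le_rfl, le_rfl⟩
    · rintro ⟨h1, h2⟩; exact ⟨0, ⟨le_rfl, zero_le_one⟩, le_antisymm h1 h2⟩
  · rw [image_mul_left_Icc ht.le zero_le_one]; simp

lemma rmx_eq {u : ℝ → ℝ} {t : ℝ} (ht : 0 ≤ t) : rmx u t = sSup (u '' Icc 0 t) := by
  rw [rmx, rmx_image ht]

lemma rmx_bdd {u : ℝ → ℝ} (hu : Continuous u) (t : ℝ) : BddAbove (u '' Icc 0 t) :=
  (isCompact_Icc.image hu).bddAbove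

lemma le_rmx {u : ℝ → ℝ} (hu : Continuous u) {s t : ℝ} (hs : 0 ≤ s) (hst : s ≤ t) : u s ≤ rmx u t := by
  rw [rmx_eq (hs.trans hst)]
  exact le_csSup (rmx_bdd hu t) ⟨s, ⟨hs, hst⟩, rfl⟩

lemma rmx_exists {u : ℝ → ℝ} (hu : Continuous u) {t : ℝ} (ht : 0 ≤ t) : ∃ s, 0 ≤ s ∧ s ≤ t ∧ rmx u t = u s := by
  obtain ⟨s, hs, h⟩ := isCompact_Icc.exists_sSup_image_eq (nonempty_Icc.2 ht) hu.continuousOn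
  exact ⟨s, hs.1, hs.2, by rw [rmx_eq ht, h]⟩

lemma rmx_mono {u : ℝ → ℝ} (hu : Continuous u) {s t : ℝ} (hs : 0 ≤ s) (hst : s ≤ t) : rmx u s ≤ rmx u t := by
  obtain ⟨r, h1, h2, h3⟩ := rmx_exists hu hs
  rw [h3]; exact le_rmx hu h1 (h2.trans hst)

/-- running maximum started at `m0` -/
noncomputable def Mc (m0 : ℝ) (u : ℝ → ℝ) (t : ℝ) : ℝ := max m0 (rmx u t)

lemma Mc_cont {u : ℝ → ℝ} (m0 : ℝ) (hu : Continuous u) : Continuous (Mc m0 u) :=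
  continuous_const.max (rmx_cont hu)

lemma Mc_mono {m0 : ℝ} {u : ℝ → ℝ} (hu : Continuous u) {s t : ℝ} (hs : 0 ≤ s) (hst : s ≤ t) :
    Mc m0 u s ≤ Mc m0 u t := max_le_max le_rfl (rmx_mono hu hs hst)

lemma mseq_le_Mc {m0 h : ℝ} {u : ℝ → ℝ} (hu : Continuous u) (hh : 0 ≤ h) (k : ℕ) :
    mseq m0 u h k ≤ Mc m0 u ((k:ℝ) * h) := by
  rcases mseq_cases m0 u h k with h1 | ⟨j, hj, h1⟩
  · rw [h1]; exact le_max_left _ _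
  · rw [h1]; exact le_trans (le_rmx hu (by positivity) (by gcongr)) (le_max_right _ _)

lemma mseq_tendsto {m0 t : ℝ} {u : ℝ → ℝ} (hu : Continuous u) (hu0 : u 0 = 0) (hm0 : 0 < m0) (ht : 0 ≤ t)
    {h : ℕ → ℝ} (hh : ∀ p, 0 < h p) (hlim : Tendsto h atTop (𝓝 0)) {n : ℕ → ℕ}
    (hn : ∀ p, t ≤ n p * h p) (hnlim : Tendsto (fun p => (n p : ℝ) * h p) atTop (𝓝 t)) :
    Tendsto (fun p => mseq m0 u (h p) (n p)) atTop (𝓝 (Mc m0 u t)) := by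
  obtain ⟨s, hs0, hst, hs⟩ := rmx_exists hu ht
  have hup := ((Mc_cont m0 hu).tendsto t).comp hnlim
  have hj : Tendsto (fun p => ((⌈s / h p⌉₊ : ℕ) : ℝ) * h p) atTop (𝓝 s) := by
    have h1 : Tendsto (fun p => s + h p) atTop (𝓝 s) := by simpa using hlim.const_add s
    refine tendsto_of_tendsto_of_tendsto_of_le_of_le tendsto_const_nhds h1 (fun p => ?_) (fun p => ?_)
    · have := Nat.le_ceil (s / h p)
      rwa [div_le_iff₀ (hh p)] at this
    · have h2 : 0 ≤ s / h p := div_nonneg hs0 (hh p).le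
      have := (Nat.ceil_lt_add_one h2).le
      have h3 := mul_le_mul_of_nonneg_right this (hh p).le
      have h4 : (s / h p + 1) * h p = s + h p := by field_simp [(hh p).ne']
      show ((⌈s / h p⌉₊ : ℕ) : ℝ) * h p ≤ s + h p
      linarith
  have hlo : Tendsto (fun p => max m0 (u (((⌈s / h p⌉₊ : ℕ) : ℝ) * h p))) atTop (𝓝 (Mc m0 u t)) := by
    unfold Mc; rw [hs]
    exact tendsto_const_nhds.max ((hu.tendsto s).comp hj)
  refine tendsto_of_tendsto_of_tendsto_of_le_of_le hlo hup (fun p => ?_) (fun p => mseq_le_Mc hu (hh p).le _)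
  refine max_le (mseq_ge _ _ _ _) ?_
  rcases Nat.eq_zero_or_pos ⌈s / h p⌉₊ with h1 | h1
  · rw [h1]; simp only [Nat.cast_zero, zero_mul, hu0]
    exact hm0.le.trans (mseq_ge _ _ _ _)
  · refine le_mseq _ _ _ h1 (Nat.ceil_le.2 ?_)
    rw [div_le_iff₀ (hh p)]
    exact hst.trans (hn p)

lemma mseq_incr_le {m0 h : ℝ} {u : ℝ → ℝ} (hu0 : u 0 = 0) (hm0 : 0 < m0) {ε : ℝ} (hε : 0 ≤ ε) (k : ℕ)
    (hk : |u (((k + 1 : ℕ) : ℝ) * h) - u ((k:ℝ) * h)| ≤ ε) :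
    mseq m0 u h (k + 1) - mseq m0 u h k ≤ ε := by
  have hm1 : mseq m0 u h (k + 1) = max (mseq m0 u h k) (u (((k + 1 : ℕ):ℝ) * h)) := rfl
  rw [hm1, sub_le_iff_le_add]
  refine max_le (by linarith) ?_
  have h2 : u ((k:ℝ) * h) ≤ mseq m0 u h k := by
    rcases Nat.eq_zero_or_pos k with rfl | h1
    · simp only [Nat.cast_zero, zero_mul, hu0]; exact hm0.le.trans (mseq_ge _ _ _ _)
    · exact le_mseq _ _ _ h1 le_rfl
  have := (abs_le.1 hk).2
  linarith

lemma sumsq_le {m0 h : ℝ} {u : ℝ → ℝ} (hm0 : 0 < m0) (N : ℕ) {ε : ℝ} (hε : 0 ≤ ε)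
    (hd : ∀ k < N, mseq m0 u h (k + 1) - mseq m0 u h k ≤ ε) :
    ∑ k ∈ Finset.range N, (mseq m0 u h (k + 1) - mseq m0 u h k) ^ 2 ≤ ε * mseq m0 u h N := by
  calc _ ≤ ∑ k ∈ Finset.range N, ε * (mseq m0 u h (k + 1) - mseq m0 u h k) := by
        refine Finset.sum_le_sum fun k hk => ?_
        have h1 := hd k (Finset.mem_range.1 hk)
        have h2 : 0 ≤ mseq m0 u h (k + 1) - mseq m0 u h k := sub_nonneg.2 (mseq_mono _ _ _ (Nat.le_succ k))
        nlinarith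
    _ = ε * (mseq m0 u h N - m0) := by
        rw [← Finset.mul_sum, Finset.sum_range_sub]; rfl
    _ ≤ _ := by gcongr; linarith

lemma sumsq_dom {m0 h : ℝ} {u : ℝ → ℝ} (hm0 : 0 < m0) (N : ℕ) :
    ∑ k ∈ Finset.range N, (mseq m0 u h (k + 1) - mseq m0 u h k) ^ 2 ≤ mseq m0 u h N ^ 2 := by
  rw [sq (mseq m0 u h N)]
  have h0 : 0 ≤ mseq m0 u h N := hm0.le.trans (mseq_ge _ _ _ _)
  refine sumsq_le hm0 N h0 fun k hk => ?_
  have h1 : mseq m0 u h (k + 1) ≤ mseq m0 u h N := mseq_mono _ _ _ hk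
  have h2 : 0 ≤ mseq m0 u h k := hm0.le.trans (mseq_ge _ _ _ _)
  linarith

lemma mesh_tendsto (T : ℝ) : Tendsto (fun p : ℕ => T / ((p:ℝ) + 1)) atTop (𝓝 0) := by
  have := (tendsto_one_div_add_atTop_nhds_zero_nat (𝕜 := ℝ)).const_mul T
  simpa [div_eq_mul_inv] using this

lemma sumsq_tendsto {m0 T : ℝ} {u : ℝ → ℝ} (hu : Continuous u) (hu0 : u 0 = 0) (hm0 : 0 < m0) (hT : 0 < T) :
    Tendsto (fun p : ℕ => ∑ k ∈ Finset.range (p + 1),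
      (mseq m0 u (T / ((p:ℝ) + 1)) (k + 1) - mseq m0 u (T / ((p:ℝ) + 1)) k) ^ 2) atTop (𝓝 0) := by
  have hM : 0 < Mc m0 u T := lt_of_lt_of_le hm0 (le_max_left _ _)
  have huc : UniformContinuousOn u (Icc 0 T) := isCompact_Icc.uniformContinuousOn_of_continuous hu.continuousOn
  rw [Metric.uniformContinuousOn_iff] at huc
  have hh : Tendsto (fun p : ℕ => T / ((p:ℝ) + 1)) atTop (𝓝 0) := mesh_tendsto T
  rw [Metric.tendsto_atTop]
  intro ε hε
  obtain ⟨δ, hδ, hδ2⟩ := huc (ε / (2 * Mc m0 u T)) (by positivity)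
  obtain ⟨p0, hp0⟩ := eventually_atTop.1 (hh.eventually (gt_mem_nhds hδ))
  refine ⟨p0, fun p hp => ?_⟩
  have hlt := hp0 p hp
  set h := T / ((p:ℝ) + 1)
  have hpos : 0 < h := by positivity
  have hNh : ((p + 1 : ℕ) : ℝ) * h = T := by simp only [h]; push_cast; field_simp
  have h1 := sumsq_le (m0 := m0) (h := h) (u := u) hm0 (p + 1) (ε := ε / (2 * Mc m0 u T)) (by positivity) (fun k hk => by
    refine mseq_incr_le hu0 hm0 (by positivity) k ?_
    have hk1 : ((k + 1 : ℕ) : ℝ) * h ≤ T := by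
      rw [← hNh]; gcongr; omega
    have hk2 : (k : ℝ) * h ≤ ((k + 1 : ℕ) : ℝ) * h := by gcongr; omega
    have := hδ2 (((k + 1 : ℕ) : ℝ) * h) ⟨by positivity, hk1⟩ ((k:ℝ) * h) ⟨by positivity, hk2.trans hk1⟩ (by
      rw [Real.dist_eq, show ((k + 1 : ℕ) : ℝ) * h - (k:ℝ) * h = h by push_cast; ring, abs_of_pos hpos]; exact hlt)
    rw [Real.dist_eq] at this
    exact this.le)
  have h2 := mseq_le_Mc (m0 := m0) hu hpos.le (p + 1)
  rw [hNh] at h2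
  have h3 : 0 ≤ ∑ k ∈ Finset.range (p + 1), (mseq m0 u h (k + 1) - mseq m0 u h k) ^ 2 :=
    Finset.sum_nonneg fun _ _ => sq_nonneg _
  rw [Real.dist_eq, sub_zero, abs_of_nonneg h3]
  calc _ ≤ _ := h1
    _ ≤ ε / (2 * Mc m0 u T) * Mc m0 u T := by gcongr
    _ = ε / 2 := by field_simp
    _ < ε := by linarith

section
variable {Ω : Type*} [m : MeasurableSpace Ω] {γ : ℝ → Ω → EuclideanSpace ℝ (Fin 4)}

lemma sg_bounds {lam T : ℝ} (hl : 0 ≤ lam) (hT : 0 < T) (ω : Ω) (hc : Continuous (pth γ ω)) (p : ℕ) :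
    stp lam T (pth γ ω) ≤ (sg γ lam (T / ((p:ℝ) + 1)) (p + 1) ω : ℝ) * (T / ((p:ℝ) + 1)) ∧
    (sg γ lam (T / ((p:ℝ) + 1)) (p + 1) ω : ℝ) * (T / ((p:ℝ) + 1)) ≤ stp lam T (pth γ ω) + T / ((p:ℝ) + 1) ∧
    (sg γ lam (T / ((p:ℝ) + 1)) (p + 1) ω : ℝ) * (T / ((p:ℝ) + 1)) ≤ T := by
  set h := T / ((p:ℝ) + 1)
  have hpos : 0 < h := by positivity
  have hNh : ((p + 1 : ℕ) : ℝ) * h = T := by simp only [h]; push_cast; field_simp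
  have hst := okDD_step (γ := γ) (lam := lam) hpos.le ω
  have hle : sg γ lam h (p + 1) ω ≤ p + 1 := cnt_le _ _
  have hleT : (sg γ lam h (p + 1) ω : ℝ) * h ≤ T := by rw [← hNh]; gcongr
  refine ⟨?_, ?_, hleT⟩
  · rcases hle.lt_or_eq with h1 | h1
    · have := cnt_spec_lt hst (p + 1) h1
      by_contra! hcon
      exact this (okDD_mono hcon.le (stp_ok hl hT.le hc))
    · rw [h1, hNh]; exact stp_le hl hT.le _
  · rcases Nat.eq_zero_or_pos (sg γ lam h (p + 1) ω) with h1 | h1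
    · rw [h1]; simp only [Nat.cast_zero, zero_mul]
      have := stp_nonneg hl hT.le (pth γ ω)
      linarith
    · have h2 := cnt_spec_pos hst (p + 1) h1
      have h3 : ((sg γ lam h (p + 1) ω - 1 : ℕ) : ℝ) = (sg γ lam h (p + 1) ω : ℝ) - 1 := by
        rw [Nat.cast_sub h1]; simp
      have h4 := le_stp (lam := lam) (T := T) (u := pth γ ω)
        (t := ((sg γ lam h (p + 1) ω - 1 : ℕ) : ℝ) * h) (by positivity) (by rw [h3]; nlinarith) h2
      rw [h3] at h4
      linarith
end

open MeasureTheory ProbabilityTheory Real Set Filter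
open scoped ENNReal Topology
set_option linter.unusedSectionVars false

section
variable {Ω : Type*} [m : MeasurableSpace Ω] {P : Measure Ω} [IsProbabilityMeasure P]
  {γ : ℝ → Ω → EuclideanSpace ℝ (Fin 4)}

lemma int_fatou {F : ℕ → Ω → ℝ} {f : Ω → ℝ} {C : ℝ} (hF : ∀ n, Integrable (F n) P)
    (hnn : ∀ n, ∀ᵐ ω ∂P, 0 ≤ F n ω) (hC : ∀ n, ∫ ω, F n ω ∂P ≤ C)
    (hlim : ∀ᵐ ω ∂P, Tendsto (fun n => F n ω) atTop (𝓝 (f ω))) :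
    Integrable f P ∧ ∫ ω, f ω ∂P ≤ C := by
  have hfm : AEStronglyMeasurable f P :=
    aestronglyMeasurable_of_tendsto_ae atTop (fun n => (hF n).aestronglyMeasurable) hlim
  have hf0 : 0 ≤ᵐ[P] f := by
    filter_upwards [hlim, ae_all_iff.2 hnn] with ω h1 h2
    exact ge_of_tendsto' h1 h2
  have hC0 : 0 ≤ C := le_trans (integral_nonneg_of_ae (hnn 0)) (hC 0)
  have h1 : ∫⁻ ω, ENNReal.ofReal (f ω) ∂P ≤ ENNReal.ofReal C := by
    have e : ∫⁻ ω, ENNReal.ofReal (f ω) ∂P = ∫⁻ ω, liminf (fun n => ENNReal.ofReal (F n ω)) atTop ∂P := by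
      refine lintegral_congr_ae ?_
      filter_upwards [hlim] with ω h
      exact ((ENNReal.tendsto_ofReal h).liminf_eq).symm
    rw [e]
    refine (lintegral_liminf_le' fun n => (hF n).aestronglyMeasurable.aemeasurable.ennreal_ofReal).trans ?_
    refine liminf_le_of_le (by isBoundedDefault) fun b hb => ?_
    obtain ⟨n, hn⟩ := hb.exists
    refine hn.trans ?_
    rw [← ofReal_integral_eq_lintegral_ofReal (hF n) (hnn n)]
    exact ENNReal.ofReal_le_ofReal (hC n)
  have hInt : Integrable f P := by
    refine ⟨hfm, ?_⟩
    rw [hasFiniteIntegral_iff_ofReal hf0]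
    exact lt_of_le_of_lt h1 ENNReal.ofReal_lt_top
  refine ⟨hInt, ?_⟩
  rw [← ofReal_integral_eq_lintegral_ofReal hInt hf0] at h1
  exact (ENNReal.ofReal_le_ofReal_iff hC0).1 h1

lemma mesh_mul (T : ℝ) (p : ℕ) : ((p + 1 : ℕ) : ℝ) * (T / ((p:ℝ) + 1)) = T := by
  push_cast; field_simp

lemma McT_sq (hγ : IsStdBMVec 4 P γ) {m0 T : ℝ} (hm0 : 0 < m0) (hT : 0 < T) :
    Integrable (fun ω => Mc m0 (pth γ ω) T ^ 2) P := by
  refine (int_fatou (F := fun p ω => mseq m0 (pth γ ω) (T / ((p:ℝ) + 1)) (p + 1) ^ 2)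
    (C := 4 * ∫ ω, (pth γ ω T) ^ 2 ∂P + 2 * m0 ^ 2)
    (fun p => (mseq_memLp hγ m0 (by positivity) _).integrable_sq)
    (fun p => Eventually.of_forall fun ω => sq_nonneg _) (fun p => ?_) (Eventually.of_forall fun ω => ?_)).1
  · have := doob hγ hm0.le (h := T / ((p:ℝ) + 1)) (by positivity) (p + 1)
    rwa [mesh_mul] at this
  · refine Tendsto.pow ?_ 2
    refine mseq_tendsto (pth_cont hγ ω) (pth_zero hγ ω) hm0 hT.le (n := fun p => p + 1) (fun p => by positivity)
      (mesh_tendsto T) (fun p => (mesh_mul T p).ge) ?_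
    simp_rw [mesh_mul]; exact tendsto_const_nhds

lemma Mc_pos {m0 : ℝ} (hm0 : 0 < m0) (u : ℝ → ℝ) (t : ℝ) : 0 < Mc m0 u t := lt_of_lt_of_le hm0 (le_max_left _ _)

lemma McT_meas (hγ : IsStdBMVec 4 P γ) {m0 T : ℝ} (hm0 : 0 < m0) (hT : 0 < T) :
    Measurable (fun ω => Mc m0 (pth γ ω) T) := by
  refine measurable_of_tendsto_metrizable (f := fun (p : ℕ) ω => mseq m0 (pth γ ω) (T / ((p:ℝ) + 1)) (p + 1))
    (fun p => mseq_meas hγ m0 _ _) (tendsto_pi_nhds.2 fun ω => ?_)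
  refine mseq_tendsto (pth_cont hγ ω) (pth_zero hγ ω) hm0 hT.le (n := fun p => p + 1) (fun p => by positivity)
      (mesh_tendsto T) (fun p => (mesh_mul T p).ge) ?_
  simp_rw [mesh_mul]; exact tendsto_const_nhds

lemma McT_int (hγ : IsStdBMVec 4 P γ) {m0 T : ℝ} (hm0 : 0 < m0) (hT : 0 < T) :
    Integrable (fun ω => Mc m0 (pth γ ω) T) P :=
  ((memLp_two_iff_integrable_sq (McT_meas hγ hm0 hT).aestronglyMeasurable).2 (McT_sq hγ hm0 hT)).integrable (by norm_num)

lemma sg_tendsto (hγ : IsStdBMVec 4 P γ) {lam T : ℝ} (hl : 0 ≤ lam) (hT : 0 < T) (ω : Ω) :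
    Tendsto (fun p : ℕ => (sg γ lam (T / ((p:ℝ) + 1)) (p + 1) ω : ℝ) * (T / ((p:ℝ) + 1))) atTop
      (𝓝 (stp lam T (pth γ ω))) := by
  have h1 : Tendsto (fun p : ℕ => stp lam T (pth γ ω) + T / ((p:ℝ) + 1)) atTop (𝓝 (stp lam T (pth γ ω))) := by
    simpa using (mesh_tendsto T).const_add (stp lam T (pth γ ω))
  exact tendsto_of_tendsto_of_tendsto_of_le_of_le tendsto_const_nhds h1
    (fun p => (sg_bounds hl hT ω (pth_cont hγ ω) p).1) (fun p => (sg_bounds hl hT ω (pth_cont hγ ω) p).2.1)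

lemma pth_sg_tendsto (hγ : IsStdBMVec 4 P γ) {lam T : ℝ} (hl : 0 ≤ lam) (hT : 0 < T) (ω : Ω) :
    Tendsto (fun p : ℕ => pth γ ω ((sg γ lam (T / ((p:ℝ) + 1)) (p + 1) ω : ℝ) * (T / ((p:ℝ) + 1)))) atTop
      (𝓝 (pth γ ω (stp lam T (pth γ ω)))) :=
  ((pth_cont hγ ω).tendsto _).comp (sg_tendsto hγ hl hT ω)

lemma mseq_sg_tendsto (hγ : IsStdBMVec 4 P γ) {m0 lam T : ℝ} (hm0 : 0 < m0) (hl : 0 ≤ lam) (hT : 0 < T) (ω : Ω) :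
    Tendsto (fun p : ℕ => mseq m0 (pth γ ω) (T / ((p:ℝ) + 1)) (sg γ lam (T / ((p:ℝ) + 1)) (p + 1) ω)) atTop
      (𝓝 (Mc m0 (pth γ ω) (stp lam T (pth γ ω)))) :=
  mseq_tendsto (pth_cont hγ ω) (pth_zero hγ ω) hm0 (stp_nonneg hl hT.le _) (fun p => by positivity)
    (mesh_tendsto T) (fun p => (sg_bounds hl hT ω (pth_cont hγ ω) p).1) (sg_tendsto hγ hl hT ω)

lemma stp_meas (hγ : IsStdBMVec 4 P γ) {lam T : ℝ} (hl : 0 ≤ lam) (hT : 0 < T) :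
    Measurable (fun ω => stp lam T (pth γ ω)) :=
  measurable_of_tendsto_metrizable (fun p => sg_meas hγ lam (by positivity) (p + 1) (F := fun k _ => (k:ℝ) * (T / ((p:ℝ) + 1)))
    (fun k => measurable_const)) (tendsto_pi_nhds.2 fun ω => sg_tendsto hγ hl hT ω)

lemma pth_stp_meas (hγ : IsStdBMVec 4 P γ) {lam T : ℝ} (hl : 0 ≤ lam) (hT : 0 < T) :
    Measurable (fun ω => pth γ ω (stp lam T (pth γ ω))) :=
  measurable_of_tendsto_metrizable (fun p => sg_meas hγ lam (by positivity) (p + 1) (F := fun k ω => pth γ ω ((k:ℝ) * (T / ((p:ℝ) + 1))))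
    (fun k => pth_meas hγ _)) (tendsto_pi_nhds.2 fun ω => pth_sg_tendsto hγ hl hT ω)

lemma Mc_stp_meas (hγ : IsStdBMVec 4 P γ) {m0 lam T : ℝ} (hm0 : 0 < m0) (hl : 0 ≤ lam) (hT : 0 < T) :
    Measurable (fun ω => Mc m0 (pth γ ω) (stp lam T (pth γ ω))) :=
  measurable_of_tendsto_metrizable (fun p => sg_meas hγ lam (by positivity) (p + 1) (F := fun k ω => mseq m0 (pth γ ω) (T / ((p:ℝ) + 1)) k)
    (fun k => mseq_meas hγ _ _ _)) (tendsto_pi_nhds.2 fun ω => mseq_sg_tendsto hγ hm0 hl hT ω)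

lemma Mc_stp_le (hγ : IsStdBMVec 4 P γ) {m0 lam T : ℝ} (hl : 0 ≤ lam) (hT : 0 < T) (ω : Ω) :
    Mc m0 (pth γ ω) (stp lam T (pth γ ω)) ≤ Mc m0 (pth γ ω) T :=
  Mc_mono (pth_cont hγ ω) (stp_nonneg hl hT.le _) (stp_le hl hT.le _)

lemma pth_le_Mc (hγ : IsStdBMVec 4 P γ) {m0 t : ℝ} (ht : 0 ≤ t) (ω : Ω) : pth γ ω t ≤ Mc m0 (pth γ ω) t :=
  (le_rmx (pth_cont hγ ω) ht le_rfl).trans (le_max_right _ _)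

lemma Mc_stp_int (hγ : IsStdBMVec 4 P γ) {m0 lam T : ℝ} (hm0 : 0 < m0) (hl : 0 ≤ lam) (hT : 0 < T) :
    Integrable (fun ω => Mc m0 (pth γ ω) (stp lam T (pth γ ω))) P := by
  refine (McT_int hγ hm0 hT).mono' (Mc_stp_meas hγ hm0 hl hT).aestronglyMeasurable (Eventually.of_forall fun ω => ?_)
  rw [Real.norm_eq_abs, abs_of_pos (Mc_pos hm0 _ _)]
  exact Mc_stp_le hγ hl hT ω

lemma pth_stp_int (hγ : IsStdBMVec 4 P γ) {lam T : ℝ} (hl : 0 ≤ lam) (hT : 0 < T) :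
    Integrable (fun ω => pth γ ω (stp lam T (pth γ ω))) P := by
  refine (Mc_stp_int hγ one_pos hl hT).mono' (pth_stp_meas hγ hl hT).aestronglyMeasurable (Eventually.of_forall fun ω => ?_)
  rw [Real.norm_eq_abs, abs_of_nonneg (pth_nonneg _ _ _)]
  exact pth_le_Mc hγ (stp_nonneg hl hT.le _) ω

lemma stp_int (hγ : IsStdBMVec 4 P γ) {lam T : ℝ} (hl : 0 ≤ lam) (hT : 0 < T) :
    Integrable (fun ω => stp lam T (pth γ ω)) P := by
  refine (integrable_const T).mono' (stp_meas hγ hl hT).aestronglyMeasurable (Eventually.of_forall fun ω => ?_)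
  rw [Real.norm_eq_abs, abs_of_nonneg (stp_nonneg hl hT.le _)]
  exact stp_le hl hT.le _

lemma cont_U (hγ : IsStdBMVec 4 P γ) {lam T : ℝ} (hl : 0 ≤ lam) (hT : 0 < T) :
    ∫ ω, pth γ ω (stp lam T (pth γ ω)) ∂P = 4 * ∫ ω, stp lam T (pth γ ω) ∂P := by
  have l1 : Tendsto (fun p : ℕ => ∫ ω, pth γ ω ((sg γ lam (T / ((p:ℝ) + 1)) (p + 1) ω : ℝ) * (T / ((p:ℝ) + 1))) ∂P) atTop
      (𝓝 (∫ ω, pth γ ω (stp lam T (pth γ ω)) ∂P)) := by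
    refine tendsto_integral_of_dominated_convergence (fun ω => Mc 1 (pth γ ω) T)
      (fun p => (sg_meas hγ lam (by positivity) (p + 1) (F := fun k ω => pth γ ω ((k:ℝ) * (T / ((p:ℝ) + 1))))
        (fun k => pth_meas hγ _)).aestronglyMeasurable) (McT_int hγ one_pos hT)
      (fun p => Eventually.of_forall fun ω => ?_) (Eventually.of_forall fun ω => pth_sg_tendsto hγ hl hT ω)
    rw [Real.norm_eq_abs, abs_of_nonneg (pth_nonneg _ _ _)]
    exact (le_rmx (pth_cont hγ ω) (by positivity) (sg_bounds hl hT ω (pth_cont hγ ω) p).2.2).trans (le_max_right _ _)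
  have l2 : Tendsto (fun p : ℕ => ∫ ω, (sg γ lam (T / ((p:ℝ) + 1)) (p + 1) ω : ℝ) * (T / ((p:ℝ) + 1)) ∂P) atTop
      (𝓝 (∫ ω, stp lam T (pth γ ω) ∂P)) := by
    refine tendsto_integral_of_dominated_convergence (fun ω => T)
      (fun p => (sg_meas hγ lam (by positivity) (p + 1) (F := fun k ω => (k:ℝ) * (T / ((p:ℝ) + 1)))
        (fun k => measurable_const)).aestronglyMeasurable) (integrable_const _)
      (fun p => Eventually.of_forall fun ω => ?_) (Eventually.of_forall fun ω => sg_tendsto hγ hl hT ω)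
    rw [Real.norm_eq_abs, abs_of_nonneg (by positivity)]
    exact (sg_bounds hl hT ω (pth_cont hγ ω) p).2.2
  refine tendsto_nhds_unique l1 ?_
  refine (l2.const_mul 4).congr fun p => ?_
  exact (disc_U hγ lam (by positivity) (p + 1)).symm

lemma Jf_abs_le {c m0 m u M : ℝ} (hc : 0 < c) (hm0 : 0 < m0) (hm : m0 ≤ m) (hM : m ≤ M) (hu : 0 ≤ u) :
    ‖Jf c m0 m u‖ ≤ M / 2 + M ^ 2 / (8 * c) := by
  unfold Jf
  have g0 := gfun_nonneg hc u
  have g1 := gfun_le hc hu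
  have a1 : 0 ≤ m ^ 2 - m0 ^ 2 := by nlinarith
  have a2 : m ^ 2 - m0 ^ 2 ≤ M ^ 2 := by nlinarith
  have a3 : 0 ≤ (m ^ 2 - m0 ^ 2) * gfun c u := by positivity
  have a4 : (m ^ 2 - m0 ^ 2) * gfun c u ≤ M ^ 2 * (1 / (2 * c)) := mul_le_mul a2 g1 g0 (by positivity)
  have a5 : M ^ 2 * (1 / (2 * c)) / 4 = M ^ 2 / (8 * c) := by field_simp; ring
  have a6 : 0 ≤ M ^ 2 / (8 * c) := by positivity
  rw [Real.norm_eq_abs, abs_le]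
  constructor <;> linarith

lemma Jf_cont (c m0 : ℝ) : Continuous (fun p : ℝ × ℝ => Jf c m0 p.1 p.2) := by
  unfold Jf
  have := gfun_continuous c
  fun_prop

lemma Jf_tendsto (c m0 : ℝ) {a b : ℕ → ℝ} {x y : ℝ} (ha : Tendsto a atTop (𝓝 x)) (hb : Tendsto b atTop (𝓝 y)) :
    Tendsto (fun n => Jf c m0 (a n) (b n)) atTop (𝓝 (Jf c m0 x y)) := by
  unfold Jf
  exact (ha.div_const 2).sub ((((ha.pow 2).sub_const _).mul (((gfun_continuous c).tendsto y).comp hb)).div_const 4)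

lemma J_sg_lim (hγ : IsStdBMVec 4 P γ) {c m0 lam T : ℝ} (hc : 0 < c) (hm0 : 0 < m0) (hl : 0 ≤ lam) (hT : 0 < T) :
    Tendsto (fun p : ℕ => ∫ ω, Jf c m0 (mseq m0 (pth γ ω) (T / ((p:ℝ) + 1)) (sg γ lam (T / ((p:ℝ) + 1)) (p + 1) ω))
      (pth γ ω ((sg γ lam (T / ((p:ℝ) + 1)) (p + 1) ω : ℝ) * (T / ((p:ℝ) + 1)))) ∂P) atTop
      (𝓝 (∫ ω, Jf c m0 (Mc m0 (pth γ ω) (stp lam T (pth γ ω))) (pth γ ω (stp lam T (pth γ ω))) ∂P)) := by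
  refine tendsto_integral_of_dominated_convergence (fun ω => Mc m0 (pth γ ω) T / 2 + Mc m0 (pth γ ω) T ^ 2 / (8 * c))
      (fun p => (sg_meas hγ lam (by positivity) (p + 1) (F := fun k ω => Jf c m0 (mseq m0 (pth γ ω) (T / ((p:ℝ) + 1)) k)
        (pth γ ω ((k:ℝ) * (T / ((p:ℝ) + 1)))))
        (fun k => (Jf_cont c m0).measurable.comp ((mseq_meas hγ _ _ _).prodMk (pth_meas hγ _)))).aestronglyMeasurable)
      (((McT_int hγ hm0 hT).div_const 2).add ((McT_sq hγ hm0 hT).div_const _))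
      (fun p => Eventually.of_forall fun ω => ?_) (Eventually.of_forall fun ω => ?_)
  · refine Jf_abs_le hc hm0 (mseq_ge _ _ _ _) ?_ (pth_nonneg _ _ _)
    exact (mseq_le_Mc (pth_cont hγ ω) (by positivity) _).trans
      (Mc_mono (pth_cont hγ ω) (by positivity) (sg_bounds hl hT ω (pth_cont hγ ω) p).2.2)
  · exact Jf_tendsto c m0 (mseq_sg_tendsto hγ hm0 hl hT ω) (pth_sg_tendsto hγ hl hT ω)

lemma cont_J_lower (hγ : IsStdBMVec 4 P γ) {c m0 lam T : ℝ} (hc : 0 < c) (hm0 : 0 < m0) (hl : 0 ≤ lam) (hT : 0 < T) :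
    m0 / 2 ≤ ∫ ω, Jf c m0 (Mc m0 (pth γ ω) (stp lam T (pth γ ω))) (pth γ ω (stp lam T (pth γ ω))) ∂P :=
  ge_of_tendsto' (J_sg_lim hγ hc hm0 hl hT) fun p => disc_J_lower hγ lam hc hm0 (by positivity) (p + 1)

lemma cont_J_upper (hγ : IsStdBMVec 4 P γ) {c m0 lam T : ℝ} (hc : 0 < c) (hm0 : 0 < m0) (hl : 0 ≤ lam) (hT : 0 < T)
    (hlam : lam < m0) :
    ∫ ω, Jf c m0 (Mc m0 (pth γ ω) (stp lam T (pth γ ω))) (pth γ ω (stp lam T (pth γ ω))) ∂P ≤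
      m0 / 2 + (exp (-(m0 / (2 * c))) / (4 * m0) + T / (8 * c ^ 2) * exp (-((m0 - lam) / (4 * c)))) *
        (4 * ∫ ω, (pth γ ω T) ^ 2 ∂P + 2 * m0 ^ 2) := by
  have l1 : Tendsto (fun p : ℕ => ∫ ω, ∑ k ∈ Finset.range (p + 1),
      (mseq m0 (pth γ ω) (T / ((p:ℝ) + 1)) (k + 1) - mseq m0 (pth γ ω) (T / ((p:ℝ) + 1)) k) ^ 2 ∂P) atTop
      (𝓝 (∫ _, (0:ℝ) ∂P)) := by
    refine tendsto_integral_of_dominated_convergence (fun ω => Mc m0 (pth γ ω) T ^ 2)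
      (fun p => (Finset.measurable_sum _ fun k _ => ((mseq_meas hγ _ _ _).sub (mseq_meas hγ _ _ _)).pow_const 2).aestronglyMeasurable)
      (McT_sq hγ hm0 hT) (fun p => Eventually.of_forall fun ω => ?_)
      (Eventually.of_forall fun ω => sumsq_tendsto (pth_cont hγ ω) (pth_zero hγ ω) hm0 hT)
    rw [Real.norm_eq_abs, abs_of_nonneg (Finset.sum_nonneg fun _ _ => sq_nonneg _)]
    refine (sumsq_dom hm0 (p + 1)).trans ?_
    have h1 := mseq_le_Mc (m0 := m0) (pth_cont hγ ω) (h := T / ((p:ℝ) + 1)) (by positivity) (p + 1)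
    rw [mesh_mul] at h1
    have h2 : 0 ≤ mseq m0 (pth γ ω) (T / ((p:ℝ) + 1)) (p + 1) := hm0.le.trans (mseq_ge _ _ _ _)
    gcongr
  rw [integral_zero] at l1
  set K := exp (-(m0 / (2 * c))) / (4 * m0) + T / (8 * c ^ 2) * exp (-((m0 - lam) / (4 * c)))
  have hK : 0 ≤ K := by positivity
  set C := 4 * ∫ ω, (pth γ ω T) ^ 2 ∂P + 2 * m0 ^ 2
  have l2 := ((l1.const_mul (1 / (4 * m0))).const_add (m0 / 2)).add_const (K * C)
  rw [mul_zero, add_zero] at l2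
  refine le_of_tendsto_of_tendsto (J_sg_lim hγ hc hm0 hl hT) l2 ?_
  filter_upwards [(mesh_tendsto T).eventually (ge_mem_nhds hc)] with p hp
  have h1 := disc_J_upper hγ hc hm0 (h := T / ((p:ℝ) + 1)) (by positivity) hp hlam (p + 1)
  have h2 := doob hγ hm0.le (h := T / ((p:ℝ) + 1)) (by positivity) (p + 1)
  rw [mesh_mul] at h1 h2
  refine h1.trans ?_
  have := mul_le_mul_of_nonneg_left h2 hK
  simp only [K, C] at this ⊢
  linarith
end

open MeasureTheory ProbabilityTheory Real Set Filter
open scoped ENNReal Topology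
set_option linter.unusedSectionVars false

lemma err_small {η T C ε : ℝ} (hη : 0 < η) (hε : 0 < ε) :
    ∃ c, 0 < c ∧ c ≤ ε ∧ (exp (-(1 / (2 * c))) / (4 * 1) + T / (8 * c ^ 2) * exp (-(η / (4 * c)))) * C ≤ ε := by
  have h1 : Tendsto (fun x : ℝ => exp (-(x / 2))) atTop (𝓝 0) := by
    have : Tendsto (fun x : ℝ => x / 2) atTop atTop := tendsto_id.atTop_div_const (by norm_num)
    exact tendsto_exp_neg_atTop_nhds_zero.comp this
  have h2 : Tendsto (fun x : ℝ => (η / 4 * x) ^ 2 * exp (-(η / 4 * x))) atTop (𝓝 0) := by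
    have : Tendsto (fun x : ℝ => η / 4 * x) atTop atTop := tendsto_id.const_mul_atTop (by positivity)
    exact (tendsto_pow_mul_exp_neg_atTop_nhds_zero 2).comp this
  have h3 : Tendsto (fun x : ℝ => (exp (-(x / 2)) / (4 * 1) + T / 8 * (4 / η) ^ 2 * ((η / 4 * x) ^ 2 * exp (-(η / 4 * x)))) * C)
      atTop (𝓝 0) := by
    have := ((h1.div_const (4 * 1)).add (h2.const_mul (T / 8 * (4 / η) ^ 2))).mul_const C
    simpa using this
  obtain ⟨x, hx1, hx2⟩ := ((h3.eventually (ge_mem_nhds hε)).and (eventually_ge_atTop (1 / ε))).exists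
  have hx0 : 0 < x := lt_of_lt_of_le (by positivity) hx2
  refine ⟨1 / x, by positivity, ?_, ?_⟩
  · rw [div_le_iff₀ hx0]
    rw [div_le_iff₀ hε] at hx2
    linarith
  · refine le_trans (le_of_eq ?_) hx1
    have e1 : 1 / (2 * (1 / x)) = x / 2 := by field_simp
    have e2 : η / (4 * (1 / x)) = η / 4 * x := by field_simp
    rw [e1, e2]
    field_simp

lemma V_nonneg {c m u : ℝ} (hc : 0 < c) (hm : 1 ≤ m) (hu : 0 ≤ u) (hmu : m - u ≤ 1) (hum : u ≤ m) :
    0 ≤ Jf c 1 m u - u / 4 := by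
  unfold Jf
  rcases hu.eq_or_lt with rfl | hu
  · have : m = 1 := by linarith
    subst this; norm_num
  · have h4 := gfun_le_inv (c := c) hu
    have h5 : (m ^ 2 - 1 ^ 2) * gfun c u ≤ (m ^ 2 - 1 ^ 2) * (1 / u) :=
      mul_le_mul_of_nonneg_left h4 (by nlinarith)
    have h6 : (m ^ 2 - 1 ^ 2) * (1 / u) ≤ 2 * m - u := by
      rw [mul_one_div, div_le_iff₀ hu]
      nlinarith
    linarith

lemma V_le {c m u : ℝ} (hc : 0 < c) (hm : 1 ≤ m) (hu : 0 ≤ u) : Jf c 1 m u - u / 4 ≤ m / 2 := by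
  unfold Jf
  have h4 := gfun_nonneg hc u
  have : 0 ≤ (m ^ 2 - 1 ^ 2) * gfun c u := mul_nonneg (by nlinarith) h4
  linarith

lemma V_tendsto {c m v : ℕ → ℝ} {u : ℝ} (hu : 0 < u) (hc : ∀ n, 0 < c n) (hc0 : Tendsto c atTop (𝓝 0))
    (hm : Tendsto m atTop (𝓝 (u + 1))) (hv : Tendsto v atTop (𝓝 u)) :
    Tendsto (fun n => Jf (c n) 1 (m n) (v n) - v n / 4) atTop (𝓝 0) := by
  have hcat : Tendsto (fun n => (c n)⁻¹) atTop atTop :=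
    (tendsto_inv_nhdsGT_zero).comp (tendsto_nhdsWithin_iff.2 ⟨hc0, Eventually.of_forall hc⟩)
  have hx : Tendsto (fun n => v n / (2 * c n)) atTop atTop := by
    have := (hv.div_const 2).pos_mul_atTop (by positivity) hcat
    refine this.congr fun n => ?_
    have := (hc n).ne'
    field_simp
  have he : Tendsto (fun n => exp (-(v n / (2 * c n)))) atTop (𝓝 0) := tendsto_exp_neg_atTop_nhds_zero.comp hx
  have hg : Tendsto (fun n => gfun (c n) (v n)) atTop (𝓝 (1 / u)) := by
    have := (he.const_sub 1).div hv hu.ne'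
    rw [sub_zero] at this
    refine this.congr' ?_
    filter_upwards [hv.eventually (lt_mem_nhds hu)] with n hn
    exact (gfun_of_pos hn).symm
  have := ((hm.div_const 2).sub ((((hm.pow 2).sub_const (1 ^ 2)).mul hg).div_const 4)).sub (hv.div_const 4)
  have e : (u + 1) / 2 - ((u + 1) ^ 2 - 1 ^ 2) * (1 / u) / 4 - u / 4 = 0 := by field_simp; ring
  rw [e] at this
  exact this

/-- levels increasing to one -/
noncomputable def lamn (n : ℕ) : ℝ := 1 - 1 / ((n:ℝ) + 2)

lemma lamn_nonneg (n : ℕ) : 0 ≤ lamn n := by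
  unfold lamn
  have : 1 / ((n:ℝ) + 2) ≤ 1 := by
    rw [div_le_one (by positivity)]; have : (0:ℝ) ≤ n := by positivity
    linarith
  linarith

lemma lamn_lt (n : ℕ) : lamn n < 1 := by
  unfold lamn
  have : 0 < 1 / ((n:ℝ) + 2) := by positivity
  linarith

lemma lamn_mono : Monotone lamn := by
  intro a b hab
  unfold lamn
  gcongr

lemma lamn_tendsto : Tendsto lamn atTop (𝓝 1) := by
  have h := (tendsto_one_div_add_atTop_nhds_zero_nat (𝕜 := ℝ)).comp (tendsto_add_atTop_nat 1)
  have h2 := h.const_sub 1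
  rw [sub_zero] at h2
  refine h2.congr fun n => ?_
  simp only [Function.comp, lamn]
  push_cast
  ring_nf

/-- approximating stopping times -/
noncomputable def sn (u : ℝ → ℝ) (n : ℕ) : ℝ := stp (lamn n) ((n:ℝ) + 1) u

lemma sn_nonneg (u : ℝ → ℝ) (n : ℕ) : 0 ≤ sn u n := stp_nonneg (lamn_nonneg n) (by positivity) u

lemma sn_ok {u : ℝ → ℝ} (hu : Continuous u) (n : ℕ) : okDD (lamn n) u (sn u n) :=
  stp_ok (lamn_nonneg n) (by positivity) hu

lemma sn_mono {u : ℝ → ℝ} (hu : Continuous u) : Monotone (sn u) := by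
  intro a b hab
  refine le_stp (sn_nonneg u a) ?_ ?_
  · refine (stp_le (lamn_nonneg a) (by positivity) u).trans ?_
    gcongr
  · intro s r h1 h2 h3
    exact (sn_ok hu a s r h1 h2 h3).trans (lamn_mono hab)

lemma rmx_sub_le {u : ℝ → ℝ} (hu : Continuous u) {lam t : ℝ} (ht : 0 ≤ t) (h : okDD lam u t) : rmx u t - u t ≤ lam := by
  obtain ⟨s, h1, h2, h3⟩ := rmx_exists hu ht
  rw [h3]; exact h s t h1 h2 le_rfl

lemma path_limit {u : ℝ → ℝ} (hu : Continuous u) {S : ℝ} (hS : Tendsto (sn u) atTop (𝓝 S)) :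
    0 ≤ S ∧ rmx u S - u S = 1 ∧ ∀ t, 0 ≤ t → t < S → rmx u t - u t < 1 := by
  have hS0 : 0 ≤ S := ge_of_tendsto' hS (sn_nonneg u)
  have hle : ∀ n, sn u n ≤ S := (sn_mono hu).ge_of_tendsto hS
  have hcD : Continuous (fun t => rmx u t - u t) := (rmx_cont hu).sub hu
  refine ⟨hS0, le_antisymm ?_ ?_, ?_⟩
  · refine le_of_tendsto' ((hcD.tendsto S).comp hS) fun n => ?_
    exact (rmx_sub_le hu (sn_nonneg u n) (sn_ok hu n)).trans (lamn_lt n).le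
  · have key : ∀ n : ℕ, S < n → ∃ r, sn u n ≤ r ∧ r ≤ sn u n + 1 / ((n:ℝ) + 1) ∧ lamn n ≤ rmx u r - u r := by
      intro n hn
      have hd1 : 1 / ((n:ℝ) + 1) ≤ 1 := by
        rw [div_le_one (by positivity)]; have : (0:ℝ) ≤ n := by positivity
        linarith
      have hd : 0 < 1 / ((n:ℝ) + 1) := by positivity
      have hnot : ¬ okDD (lamn n) u (sn u n + 1 / ((n:ℝ) + 1)) := by
        intro hok
        have := le_stp (T := (n:ℝ) + 1) (by have := sn_nonneg u n; positivity) (by have := hle n; linarith) hok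
        have h2 : stp (lamn n) ((n:ℝ) + 1) u = sn u n := rfl
        linarith
      unfold okDD at hnot
      push Not at hnot
      obtain ⟨s, r, h1, h2, h3, h4⟩ := hnot
      refine ⟨r, ?_, h3, ?_⟩
      · by_contra! hcon
        have := sn_ok hu n s r h1 h2 hcon.le
        linarith
      · have := le_rmx hu h1 h2
        linarith
    have hev : ∀ᶠ n : ℕ in atTop, S < n := (tendsto_natCast_atTop_atTop (R := ℝ)).eventually (eventually_gt_atTop S)
    have hr : ∀ n : ℕ, ∃ r, S < n → sn u n ≤ r ∧ r ≤ sn u n + 1 / ((n:ℝ) + 1) ∧ lamn n ≤ rmx u r - u r := by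
      intro n
      by_cases h : S < n
      · obtain ⟨r, hr⟩ := key n h; exact ⟨r, fun _ => hr⟩
      · exact ⟨0, fun h' => absurd h' h⟩
    choose r hr using hr
    have hrl : Tendsto r atTop (𝓝 S) := by
      have hup : Tendsto (fun n : ℕ => sn u n + 1 / ((n:ℝ) + 1)) atTop (𝓝 S) := by
        simpa using hS.add (tendsto_one_div_add_atTop_nhds_zero_nat (𝕜 := ℝ))
      refine tendsto_of_tendsto_of_tendsto_of_le_of_le' hS hup ?_ ?_
      · filter_upwards [hev] with n hn using (hr n hn).1
      · filter_upwards [hev] with n hn using (hr n hn).2.1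
    refine le_of_tendsto_of_tendsto lamn_tendsto ((hcD.tendsto S).comp hrl) ?_
    filter_upwards [hev] with n hn using (hr n hn).2.2
  · intro t ht htS
    obtain ⟨n, hn⟩ := (hS.eventually (lt_mem_nhds htS)).exists
    have := rmx_sub_le hu ht (okDD_mono hn.le (sn_ok hu n))
    have := lamn_lt n
    linarith

section
variable {Ω : Type*} [m : MeasurableSpace Ω] {P : Measure Ω} [IsProbabilityMeasure P]
  {γ : ℝ → Ω → EuclideanSpace ℝ (Fin 4)}

lemma ddTime_eq (hγ : IsStdBMVec 4 P γ) (ω : Ω) {S : ℝ} (hS : Tendsto (sn (pth γ ω)) atTop (𝓝 S)) :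
    ddTime 1 (sqBessel4 γ) ω = S := by
  obtain ⟨h0, h1, h2⟩ := path_limit (pth_cont hγ ω) hS
  have hrm : ∀ t, 0 ≤ t → runMax (sqBessel4 γ) t ω = rmx (pth γ ω) t := by
    intro t ht
    rw [rmx_eq ht, sSup_image']
    rfl
  unfold ddTime
  refine IsLeast.csInf_eq ⟨⟨h0, ?_⟩, ?_⟩
  · rw [hrm S h0]; exact h1.ge
  · rintro t ⟨ht0, ht⟩
    by_contra! hcon
    have h3 := h2 t ht0 hcon
    rw [hrm t ht0] at ht
    have : sqBessel4 γ t ω = pth γ ω t := rfl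
    linarith

lemma J_stp_int (hγ : IsStdBMVec 4 P γ) {c m0 lam T : ℝ} (hc : 0 < c) (hm0 : 0 < m0) (hl : 0 ≤ lam) (hT : 0 < T) :
    Integrable (fun ω => Jf c m0 (Mc m0 (pth γ ω) (stp lam T (pth γ ω))) (pth γ ω (stp lam T (pth γ ω)))) P := by
  refine Integrable.mono' (((McT_int hγ hm0 hT).div_const 2).add ((McT_sq hγ hm0 hT).div_const (8 * c)))
    ((Jf_cont c m0).measurable.comp ((Mc_stp_meas hγ hm0 hl hT).prodMk (pth_stp_meas hγ hl hT))).aestronglyMeasurable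
    (Eventually.of_forall fun ω => ?_)
  exact Jf_abs_le hc hm0 (le_max_left _ _) (Mc_stp_le hγ hl hT ω) (pth_nonneg _ _ _)

theorem main_thm (hγ : IsStdBMVec 4 P γ) : ∫ ω, ddTime 1 (sqBessel4 γ) ω ∂P = 1 / 2 := by
  have hT : ∀ n : ℕ, (0:ℝ) < (n:ℝ) + 1 := fun n => by positivity
  -- choice of regularisation levels
  have hex : ∀ n : ℕ, ∃ c, 0 < c ∧ c ≤ 1 / ((n:ℝ) + 1) ∧
      ∫ ω, Jf c 1 (Mc 1 (pth γ ω) (sn (pth γ ω) n)) (pth γ ω (sn (pth γ ω) n)) ∂P ≤ 1 / 2 + 1 / ((n:ℝ) + 1) := by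
    intro n
    have hη : 0 < 1 - lamn n := by have := lamn_lt n; linarith
    obtain ⟨c, h1, h2, h3⟩ := err_small (T := (n:ℝ) + 1) (C := 4 * ∫ ω, (pth γ ω ((n:ℝ) + 1)) ^ 2 ∂P + 2 * 1 ^ 2) hη
      (ε := 1 / ((n:ℝ) + 1)) (by positivity)
    refine ⟨c, h1, h2, ?_⟩
    have := cont_J_upper hγ h1 one_pos (lamn_nonneg n) (hT n) (lamn_lt n)
    unfold sn
    linarith
  choose c hc0 hc1 hcJ using hex
  have hn0 : Tendsto (fun n : ℕ => 1 / ((n:ℝ) + 1)) atTop (𝓝 0) := tendsto_one_div_add_atTop_nhds_zero_nat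
  have hclim : Tendsto c atTop (𝓝 0) :=
    tendsto_of_tendsto_of_tendsto_of_le_of_le tendsto_const_nhds hn0 (fun n => (hc0 n).le) hc1
  have hcJ' : ∀ n, 1 / 2 ≤ ∫ ω, Jf (c n) 1 (Mc 1 (pth γ ω) (sn (pth γ ω) n)) (pth γ ω (sn (pth γ ω) n)) ∂P :=
    fun n => cont_J_lower hγ (hc0 n) one_pos (lamn_nonneg n) (hT n)
  -- integrability
  have is : ∀ n, Integrable (fun ω => sn (pth γ ω) n) P := fun n => stp_int hγ (lamn_nonneg n) (hT n)
  have iu : ∀ n, Integrable (fun ω => pth γ ω (sn (pth γ ω) n)) P := fun n => pth_stp_int hγ (lamn_nonneg n) (hT n)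
  have im : ∀ {m0 : ℝ}, 0 < m0 → ∀ n, Integrable (fun ω => Mc m0 (pth γ ω) (sn (pth γ ω) n)) P :=
    fun hm0 n => Mc_stp_int hγ hm0 (lamn_nonneg n) (hT n)
  have iJ : ∀ {m0 c : ℝ}, 0 < c → 0 < m0 → ∀ n, Integrable (fun ω => Jf c m0 (Mc m0 (pth γ ω) (sn (pth γ ω) n)) (pth γ ω (sn (pth γ ω) n))) P :=
    fun hc hm0 n => J_stp_int hγ hc hm0 (lamn_nonneg n) (hT n)
  have hU : ∀ n, ∫ ω, pth γ ω (sn (pth γ ω) n) ∂P = 4 * ∫ ω, sn (pth γ ω) n ∂P := fun n =>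
    cont_U hγ (lamn_nonneg n) (hT n)
  have hmu : ∀ n ω, Mc 1 (pth γ ω) (sn (pth γ ω) n) - pth γ ω (sn (pth γ ω) n) ≤ 1 := by
    intro n ω
    have h1 := rmx_sub_le (pth_cont hγ ω) (sn_nonneg _ n) (sn_ok (pth_cont hγ ω) n)
    have h2 := lamn_lt n
    have h3 := pth_nonneg γ ω (sn (pth γ ω) n)
    rw [sub_le_iff_le_add]
    exact max_le (by linarith) (by linarith)
  have hum : ∀ n ω, pth γ ω (sn (pth γ ω) n) ≤ Mc 1 (pth γ ω) (sn (pth γ ω) n) := fun n ω =>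
    pth_le_Mc hγ (sn_nonneg _ n) ω
  set V : ℕ → Ω → ℝ := fun n ω => Jf (c n) 1 (Mc 1 (pth γ ω) (sn (pth γ ω) n)) (pth γ ω (sn (pth γ ω) n)) -
    pth γ ω (sn (pth γ ω) n) / 4 with hVdef
  have hV0 : ∀ n ω, 0 ≤ V n ω := fun n ω =>
    V_nonneg (hc0 n) (le_max_left _ _) (pth_nonneg _ _ _) (hmu n ω) (hum n ω)
  have hVle : ∀ n ω, V n ω ≤ Mc 1 (pth γ ω) (sn (pth γ ω) n) / 2 := fun n ω =>
    V_le (hc0 n) (le_max_left _ _) (pth_nonneg _ _ _)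
  have iV : ∀ n, Integrable (V n) P := fun n => (iJ (hc0 n) one_pos n).sub ((iu n).div_const 4)
  have hVE : ∀ n, ∫ ω, V n ω ∂P =
      ∫ ω, Jf (c n) 1 (Mc 1 (pth γ ω) (sn (pth γ ω) n)) (pth γ ω (sn (pth γ ω) n)) ∂P - ∫ ω, sn (pth γ ω) n ∂P := by
    intro n
    rw [hVdef]
    simp only
    rw [integral_sub (iJ (hc0 n) one_pos n) ((iu n).div_const 4), integral_div, hU]
    ring
  have hsE : ∀ n, ∫ ω, sn (pth γ ω) n ∂P ≤ 3 / 2 := by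
    intro n
    have h1 := hVE n
    have h2 : 0 ≤ ∫ ω, V n ω ∂P := integral_nonneg (hV0 n)
    have h3 := hcJ n
    have hd1 : 1 / ((n:ℝ) + 1) ≤ 1 := by
      rw [div_le_one (by positivity)]; have : (0:ℝ) ≤ n := by positivity
      linarith
    linarith
  have hmE : ∀ n, ∫ ω, Mc 1 (pth γ ω) (sn (pth γ ω) n) ∂P ≤ 7 := by
    intro n
    have h1 : ∫ ω, Mc 1 (pth γ ω) (sn (pth γ ω) n) ∂P ≤ ∫ ω, (pth γ ω (sn (pth γ ω) n) + 1) ∂P :=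
      integral_mono (im one_pos n) ((iu n).add (integrable_const 1)) fun ω => by
        have := hmu n ω
        show Mc 1 (pth γ ω) (sn (pth γ ω) n) ≤ pth γ ω (sn (pth γ ω) n) + 1
        linarith
    rw [integral_add (iu n) (integrable_const 1), hU] at h1
    simp only [integral_const, probReal_univ, smul_eq_mul, one_mul] at h1
    have := hsE n
    linarith
  -- almost sure convergence of the times
  have msn : ∀ n, Measurable (fun ω => sn (pth γ ω) n) := fun n => stp_meas hγ (lamn_nonneg n) (hT n)
  have hbdd : ∀ᵐ ω ∂P, Tendsto (sn (pth γ ω)) atTop (𝓝 (⨆ n, sn (pth γ ω) n)) := by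
    have hl : ∫⁻ ω, ⨆ n, ENNReal.ofReal (sn (pth γ ω) n) ∂P ≤ ENNReal.ofReal (3 / 2) := by
      rw [lintegral_iSup (fun n => (msn n).ennreal_ofReal)
        (fun a b hab ω => ENNReal.ofReal_le_ofReal (sn_mono (pth_cont hγ ω) hab))]
      refine iSup_le fun n => ?_
      rw [← ofReal_integral_eq_lintegral_ofReal (is n) (Eventually.of_forall fun ω => sn_nonneg _ n)]
      exact ENNReal.ofReal_le_ofReal (hsE n)
    have := ae_lt_top (Measurable.iSup fun n => (msn n).ennreal_ofReal)
      (ne_of_lt (lt_of_le_of_lt hl ENNReal.ofReal_lt_top))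
    filter_upwards [this] with ω hω
    refine tendsto_atTop_ciSup (sn_mono (pth_cont hγ ω)) ⟨(⨆ n, ENNReal.ofReal (sn (pth γ ω) n)).toReal, ?_⟩
    rintro _ ⟨n, rfl⟩
    rw [← ENNReal.ofReal_le_iff_le_toReal hω.ne]
    exact le_iSup (fun n => ENNReal.ofReal (sn (pth γ ω) n)) n
  set S : Ω → ℝ := fun ω => ⨆ n, sn (pth γ ω) n with hSdef
  have hS : ∀ᵐ ω ∂P, Tendsto (sn (pth γ ω)) atTop (𝓝 (S ω)) := hbdd
  have hdd : ∫ ω, ddTime 1 (sqBessel4 γ) ω ∂P = ∫ ω, S ω ∂P := by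
    refine integral_congr_ae ?_
    filter_upwards [hS] with ω hω using ddTime_eq hγ ω hω
  have iS : Integrable S P := (int_fatou is (fun n => Eventually.of_forall fun ω => sn_nonneg _ n) hsE hS).1
  have hmlim : ∀ m0 : ℝ, ∀ᵐ ω ∂P, Tendsto (fun n => Mc m0 (pth γ ω) (sn (pth γ ω) n)) atTop (𝓝 (Mc m0 (pth γ ω) (S ω))) := by
    intro m0
    filter_upwards [hS] with ω hω
    exact ((Mc_cont m0 (pth_cont hγ ω)).tendsto _).comp hω
  have hulim : ∀ᵐ ω ∂P, Tendsto (fun n => pth γ ω (sn (pth γ ω) n)) atTop (𝓝 (pth γ ω (S ω))) := by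
    filter_upwards [hS] with ω hω
    exact ((pth_cont hγ ω).tendsto _).comp hω
  have iM : Integrable (fun ω => Mc 1 (pth γ ω) (S ω)) P :=
    (int_fatou (im one_pos) (fun n => Eventually.of_forall fun ω => (Mc_pos one_pos _ _).le) hmE (hmlim 1)).1
  have hMS : ∀ᵐ ω ∂P, rmx (pth γ ω) (S ω) = pth γ ω (S ω) + 1 := by
    filter_upwards [hS] with ω hω
    have := (path_limit (pth_cont hγ ω) hω).2.1
    linarith
  -- the limit does not sit at zero
  have hpos : ∀ᵐ ω ∂P, 0 < pth γ ω (S ω) := by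
    have key : ∀ c : ℝ, 0 < c → P.real {ω | ¬ 0 < pth γ ω (S ω)} ≤ 14 * (8 * c / 3) := by
      intro c hc
      have iF : ∀ n, Integrable (fun ω => (Mc (1/2) (pth γ ω) (sn (pth γ ω) n) ^ 2 - (1/2) ^ 2) * gfun c (pth γ ω (sn (pth γ ω) n))) P := by
        intro n
        have := (((im (m0 := 1/2) (by norm_num) n).div_const 2).sub (iJ (m0 := 1/2) hc (by norm_num) n)).const_mul 4
        refine this.congr (Eventually.of_forall fun ω => ?_)
        simp only [Pi.sub_apply, Jf]
        ring
      have hEF : ∀ n, ∫ ω, (Mc (1/2) (pth γ ω) (sn (pth γ ω) n) ^ 2 - (1/2) ^ 2) * gfun c (pth γ ω (sn (pth γ ω) n)) ∂P ≤ 14 := by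
        intro n
        have h1 := cont_J_lower hγ hc (m0 := 1/2) (by norm_num) (lamn_nonneg n) (hT n)
        have e : ∫ ω, Jf c (1/2) (Mc (1/2) (pth γ ω) (sn (pth γ ω) n)) (pth γ ω (sn (pth γ ω) n)) ∂P =
          (∫ ω, Mc (1/2) (pth γ ω) (sn (pth γ ω) n) ∂P) / 2 -
          (∫ ω, (Mc (1/2) (pth γ ω) (sn (pth γ ω) n) ^ 2 - (1/2) ^ 2) * gfun c (pth γ ω (sn (pth γ ω) n)) ∂P) / 4 := by
          rw [← integral_div, ← integral_div, ← integral_sub ((im (by norm_num) n).div_const 2) ((iF n).div_const 4)]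
          rfl
        have h2 : ∫ ω, Mc (1/2) (pth γ ω) (sn (pth γ ω) n) ∂P ≤ ∫ ω, Mc 1 (pth γ ω) (sn (pth γ ω) n) ∂P :=
          integral_mono (im (by norm_num) n) (im one_pos n) fun ω => max_le_max (by norm_num) le_rfl
        have h3 := hmE n
        unfold sn at e h2 h3 ⊢
        linarith
      obtain ⟨iL, hL⟩ := int_fatou (f := fun ω => (Mc (1/2) (pth γ ω) (S ω) ^ 2 - (1/2) ^ 2) * gfun c (pth γ ω (S ω))) iF
        (fun n => Eventually.of_forall fun ω => by
          have : (1/2 : ℝ) ≤ Mc (1/2) (pth γ ω) (sn (pth γ ω) n) := le_max_left _ _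
          exact mul_nonneg (by nlinarith) (gfun_nonneg hc _)) hEF (by
          filter_upwards [hmlim (1/2), hulim] with ω h1 h2
          exact ((h1.pow 2).sub_const _).mul (((gfun_continuous c).tendsto _).comp h2))
      have hmk := mul_meas_ge_le_integral_of_nonneg (Eventually.of_forall fun ω => by
          have : (1/2 : ℝ) ≤ Mc (1/2) (pth γ ω) (S ω) := le_max_left _ _
          exact mul_nonneg (by nlinarith) (gfun_nonneg hc _)) iL (3 / (8 * c))
      have hsub : P.real {ω | ¬ 0 < pth γ ω (S ω)} ≤
          P.real {ω | 3 / (8 * c) ≤ (Mc (1/2) (pth γ ω) (S ω) ^ 2 - (1/2) ^ 2) * gfun c (pth γ ω (S ω))} := by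
        refine ENNReal.toReal_mono (measure_ne_top _ _) (measure_mono_ae ?_)
        filter_upwards [hMS] with ω h1 h2
        have h3 : pth γ ω (S ω) = 0 := le_antisymm (not_lt.1 h2) (pth_nonneg _ _ _)
        show 3 / (8 * c) ≤ (Mc (1/2) (pth γ ω) (S ω) ^ 2 - (1/2) ^ 2) * gfun c (pth γ ω (S ω))
        unfold Mc
        rw [h1, h3, gfun_zero]
        refine le_of_eq ?_
        norm_num
        field_simp
        norm_num
      have h4 : 3 / (8 * c) * P.real {ω | ¬ 0 < pth γ ω (S ω)} ≤ 14 :=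
        (mul_le_mul_of_nonneg_left hsub (by positivity)).trans (hmk.trans hL)
      have h5 : P.real {ω | ¬ 0 < pth γ ω (S ω)} = (3 / (8 * c) * P.real {ω | ¬ 0 < pth γ ω (S ω)}) * (8 * c / 3) := by
        field_simp
      rw [h5]
      gcongr
    have hz : P.real {ω | ¬ 0 < pth γ ω (S ω)} ≤ 0 := by
      refine le_of_forall_pos_le_add fun ε hε => ?_
      have := key (ε * 3 / (14 * 8)) (by positivity)
      refine this.trans (le_of_eq ?_)
      ring
    have hz2 : P.real {ω | ¬ 0 < pth γ ω (S ω)} = 0 := le_antisymm hz measureReal_nonneg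
    rw [measureReal_eq_zero_iff] at hz2
    exact hz2
  -- conclusion
  have hVlim : Tendsto (fun n => ∫ ω, V n ω ∂P) atTop (𝓝 (∫ _, (0:ℝ) ∂P)) := by
    refine tendsto_integral_of_dominated_convergence (fun ω => Mc 1 (pth γ ω) (S ω) / 2)
      (fun n => (iV n).aestronglyMeasurable) (iM.div_const 2) (fun n => ?_) ?_
    · filter_upwards [hS] with ω hω
      rw [Real.norm_eq_abs, abs_of_nonneg (hV0 n ω)]
      refine (hVle n ω).trans ?_
      have := Mc_mono (m0 := 1) (pth_cont hγ ω) (sn_nonneg _ n) ((sn_mono (pth_cont hγ ω)).ge_of_tendsto hω n)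
      linarith
    · filter_upwards [hpos, hMS, hmlim 1, hulim] with ω h1 h2 h3 h4
      have h5 : Mc 1 (pth γ ω) (S ω) = pth γ ω (S ω) + 1 := by
        unfold Mc; rw [h2]; exact max_eq_right (by linarith)
      rw [h5] at h3
      exact V_tendsto h1 hc0 hclim h3 h4
  rw [integral_zero] at hVlim
  have hJlim : Tendsto (fun n => ∫ ω, Jf (c n) 1 (Mc 1 (pth γ ω) (sn (pth γ ω) n)) (pth γ ω (sn (pth γ ω) n)) ∂P) atTop (𝓝 (1/2)) := by
    have : Tendsto (fun n : ℕ => (1/2 : ℝ) + 1 / ((n:ℝ) + 1)) atTop (𝓝 (1/2)) := by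
      simpa using hn0.const_add (1/2 : ℝ)
    exact tendsto_of_tendsto_of_tendsto_of_le_of_le tendsto_const_nhds this hcJ' hcJ
  have hslim : Tendsto (fun n => ∫ ω, sn (pth γ ω) n ∂P) atTop (𝓝 (1/2)) := by
    have := hJlim.sub hVlim
    rw [sub_zero] at this
    refine this.congr fun n => ?_
    rw [hVE]; ring
  have hslim2 : Tendsto (fun n => ∫ ω, sn (pth γ ω) n ∂P) atTop (𝓝 (∫ ω, S ω ∂P)) := by
    refine tendsto_integral_of_dominated_convergence S (fun n => (is n).aestronglyMeasurable) iS (fun n => ?_) hS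
    filter_upwards [hS] with ω hω
    rw [Real.norm_eq_abs, abs_of_nonneg (sn_nonneg _ n)]
    exact (sn_mono (pth_cont hγ ω)).ge_of_tendsto hω n
  rw [hdd]
  exact tendsto_nhds_unique hslim2 hslim
end

end Helpers

open scoped ENNReal

/-- for a squared four-dimensional Bessel process `U` started at `0` and
`τ₁ := inf {t ≥ 0 : Ū(t) - U(t) ≥ 1}`, one has `E[τ₁] = 1/2`. -/
theorem sqBessel4_drawdown_time_expectation
    {Ω : Type*} [MeasurableSpace Ω] (P : Measure Ω) [IsProbabilityMeasure P]
    (γ : ℝ → Ω → EuclideanSpace ℝ (Fin 4)) (hγ : IsStdBMVec 4 P γ) :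
    ∫ ω, ddTime 1 (sqBessel4 γ) ω ∂P = 1 / 2 := by
  exact main_thm hγ
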